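/- arXiv:2207.00920 — 2 statements merged into one kernel-verified Lean document; each statement's English description precedes it below -/
import Mathlib

section
/- Let H = ℚ^n with standard basis e_1,…,e_n and dual basis e_1*,…,e_n*. For n ≥ p + q, the traceless part T_{p,q} := ⋂_{(k,l)∈[p]×[q]} ker(c_{k,l}) ⊆ H^{⊗p} ⊗ (H*)^{⊗q} is generated as a GL(n,ℚ)-representation by the single element e_{p,q} = e_1 ⊗ ⋯ ⊗ e_p ⊗ e_n* ⊗ ⋯ ⊗ e_{n-q+1}*. -/
/-!
STATEMENT 4.  `H = ℚⁿ` with standard basis `e_1, …, e_n`.  We work with the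
coordinates of tensors in `H^{⊗p} ⊗ (H*)^{⊗q}` with respect to the standard basis
and its dual basis: a tensor is a function `(Fin p → Fin n) × (Fin q → Fin n) → ℚ`.
The traceless part `T_{p,q}` is the intersection of the kernels of all contraction
maps `c_{k,l}`, and `GL(n,ℚ)` acts diagonally (on the `H*`-factors via the inverse
transpose).  The claim: for `n ≥ p + q`, `T_{p,q}` is generated as a
`GL(n,ℚ)`-representation by `e_{p,q} = e_1 ⊗ ⋯ ⊗ e_p ⊗ e_n* ⊗ ⋯ ⊗ e_{n-q+1}*`,
i.e. `T_{p,q}` is the span of the orbit of `e_{p,q}`.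
-/

/-- Coordinates of `H^{⊗p} ⊗ (H*)^{⊗q}` for `H = ℚⁿ`. -/
abbrev Tens (n p q : ℕ) : Type := ((Fin p → Fin n) × (Fin q → Fin n)) → ℚ

/-- The traceless part `T_{p,q}`: common kernel of all contractions `c_{k,l}`,
pairing the `k`-th `H`-factor with the `l`-th `H*`-factor. -/
def Traceless (n p q : ℕ) : Submodule ℚ (Tens n p q) :=
  ⨅ (k : Fin p) (l : Fin q) (I : Fin p → Fin n) (J : Fin q → Fin n),
    LinearMap.ker (∑ m : Fin n,
      (LinearMap.proj (Function.update I k m, Function.update J l m) :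
        Tens n p q →ₗ[ℚ] ℚ))

/-- The (coordinate form of the) action of `g ∈ GL(n,ℚ)` on `H^{⊗p} ⊗ (H*)^{⊗q}`:
the `H`-factors transform via the matrix `g`, the `H*`-factors via the inverse
transpose of `g`. -/
noncomputable def rho (n p q : ℕ) (g : GL (Fin n) ℚ) : Tens n p q →ₗ[ℚ] Tens n p q :=
  LinearMap.pi fun IJ =>
    ∑ KL : (Fin p → Fin n) × (Fin q → Fin n),
      ((∏ k : Fin p, (g : Matrix (Fin n) (Fin n) ℚ) (IJ.1 k) (KL.1 k)) *
       (∏ l : Fin q, ((g⁻¹ : GL (Fin n) ℚ) : Matrix (Fin n) (Fin n) ℚ) (KL.2 l) (IJ.2 l)))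
        • (LinearMap.proj KL : Tens n p q →ₗ[ℚ] ℚ)

/-- The basis tensor `e_{p,q} = e_1 ⊗ ⋯ ⊗ e_p ⊗ e_n* ⊗ ⋯ ⊗ e_{n-q+1}*`
(in 0-based coordinates). -/
def epq (n p q : ℕ) : Tens n p q := fun IJ =>
  if (∀ k : Fin p, (IJ.1 k : ℕ) = (k : ℕ)) ∧ (∀ l : Fin q, (IJ.2 l : ℕ) = n - 1 - (l : ℕ))
  then 1 else 0

namespace TL
open Finset Function

variable {n p q : ℕ}

/-- Infinitesimal action of the elementary matrix. -/
def D (a b : Fin n) (y : Tens n p q) : Tens n p q := fun IJ =>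
  (∑ k, if IJ.1 k = a then y (update IJ.1 k b, IJ.2) else 0) -
  ∑ l, if IJ.2 l = b then y (IJ.1, update IJ.2 l a) else 0

/-- Number of dual slots whose label also occurs among the vector slots. -/
def ov (I : Fin p → Fin n) (J : Fin q → Fin n) : ℕ :=
  (univ.filter fun l => ∃ k, I k = J l).card

lemma rel1 (y : Tens n p q) (a b : Fin n) (I : Fin p → Fin n) (J : Fin q → Fin n) (k : Fin p)
    (hk : ∀ j, I j = b ↔ j = k) :
    D b a y (I, J) = y (update I k a, J) - ∑ l, if J l = a then y (I, update J l b) else 0 := by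
  simp [D, hk]

lemma rel2 (y : Tens n p q) (a b : Fin n) (I : Fin p → Fin n) (J : Fin q → Fin n) (l : Fin q)
    (hl : ∀ j, J j = b ↔ j = l) :
    D a b y (I, J) = (∑ k, if I k = a then y (update I k b, J) else 0) - y (I, update J l a) := by
  simp [D, hl]

lemma mem_traceless (y : Tens n p q) : y ∈ Traceless n p q ↔
    ∀ k l I J, ∑ m, y (update I k m, update J l m) = 0 := by
  simp [Traceless, Submodule.mem_iInf, LinearMap.sum_apply]

lemma D_traceless (a b : Fin n) (y : Tens n p q) (hy : y ∈ Traceless n p q) :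
    D a b y ∈ Traceless n p q := by
  rw [mem_traceless] at *
  intro k l I J
  simp only [D, sum_sub_distrib]
  rw [sum_comm, sum_comm (s := univ) (t := univ (α := Fin q))]
  rw [← add_sum_erase _ _ (mem_univ k), ← add_sum_erase _ _ (mem_univ l)]
  have h1 : ∀ j ∈ univ.erase k, (∑ m, if update I k m j = a then
      y (update (update I k m) j b, update J l m) else 0) = 0 := by
    intro j hj
    have hj : j ≠ k := by simpa using hj
    simp only [update_of_ne hj]
    by_cases h : I j = a
    · simp only [h, if_true, update_comm hj.symm]
      exact hy ..
    · simp [h]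
  have h2 : ∀ j ∈ univ.erase l, (∑ m, if update J l m j = b then
      y (update I k m, update (update J l m) j a) else 0) = 0 := by
    intro j hj
    have hj : j ≠ l := by simpa using hj
    simp only [update_of_ne hj]
    by_cases h : J j = b
    · simp only [h, if_true, update_comm hj.symm]
      exact hy ..
    · simp [h]
  rw [sum_eq_zero h1, sum_eq_zero h2]
  simp

lemma card_image_update_ge {s : ℕ} (J : Fin s → Fin n) (l : Fin s) (b : Fin n)
    (hb : ∀ j, J j ≠ b) : (univ.image J).card ≤ (univ.image (update J l b)).card := by
  have : insert b ((univ.image J).erase (J l)) ⊆ univ.image (update J l b) := by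
    intro x hx
    simp only [mem_insert, mem_erase, mem_image, mem_univ, true_and] at hx ⊢
    rcases hx with rfl | ⟨h1, j, rfl⟩
    · exact ⟨l, by simp⟩
    · refine ⟨j, update_of_ne ?_ _ _⟩
      rintro rfl; exact h1 rfl
  have h2 := card_le_card this
  rw [card_insert_of_notMem (by simp [hb]), card_erase_of_mem (by simp)] at h2
  omega

lemma card_image_update_gt {s : ℕ} (J : Fin s → Fin n) (l l' : Fin s) (b : Fin n)
    (hb : ∀ j, J j ≠ b) (hl : l' ≠ l) (hJ : J l' = J l) :
    (univ.image J).card < (univ.image (update J l b)).card := by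
  have : insert b (univ.image J) ⊆ univ.image (update J l b) := by
    intro x hx
    simp only [mem_insert, mem_image, mem_univ, true_and] at hx ⊢
    rcases hx with rfl | ⟨j, rfl⟩
    · exact ⟨l, by simp⟩
    · by_cases h : j = l
      · exact ⟨l', by rw [update_of_ne hl, hJ, h]⟩
      · exact ⟨j, update_of_ne h _ _⟩
  have h2 := card_le_card this
  rw [card_insert_of_notMem (by simp [hb])] at h2
  omega

lemma exists_unused (I : Fin p → Fin n) (J : Fin q → Fin n)
    (h : (univ.image I ∪ univ.image J).card < n) : ∃ b, (∀ j, I j ≠ b) ∧ ∀ j, J j ≠ b := by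
  by_contra hc
  push Not at hc
  have : univ.image I ∪ univ.image J = univ := by
    ext x
    simp only [mem_union, mem_image, mem_univ, true_and, iff_true]
    by_contra h3
    push Not at h3
    obtain ⟨j, hj⟩ := hc x h3.1
    exact h3.2 j hj
  rw [this] at h
  simp at h

lemma reduce (N : Set (Tens n p q)) (hn : p + q ≤ n)
    (hD : ∀ y ∈ N, ∀ a b, a ≠ b → D a b y ∈ N) (r : ℕ)
    (hinj : ∀ y ∈ N, ∀ I J, Injective I → Injective J → ov I J < r → y (I, J) = 0) :
    ∀ d, ∀ y ∈ N, ∀ I J, p + q ≤ (univ.image I).card + (univ.image J).card + d →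
      ov I J < r → y (I, J) = 0 := by
  intro d
  induction d with
  | zero =>
    intro y hy I J hc ho
    have h1 : (univ.image I).card ≤ p := by simpa using card_image_le (s := univ) (f := I)
    have h2 : (univ.image J).card ≤ q := by simpa using card_image_le (s := univ) (f := J)
    refine hinj y hy I J ?_ ?_ ho
    · have : (univ.image I).card = (univ : Finset (Fin p)).card := by simp; omega
      simpa using card_image_iff.1 this
    · have : (univ.image J).card = (univ : Finset (Fin q)).card := by simp; omega
      simpa using card_image_iff.1 this
  | succ d ih =>
    intro y hy I J hc ho
    have h1 : (univ.image I).card ≤ p := by simpa using card_image_le (s := univ) (f := I)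
    have h2 : (univ.image J).card ≤ q := by simpa using card_image_le (s := univ) (f := J)
    by_cases hlt : p + q ≤ (univ.image I).card + (univ.image J).card
    · exact ih y hy I J (by omega) ho
    obtain ⟨b, hbI, hbJ⟩ := exists_unused I J (by
      have := card_union_le (univ.image I) (univ.image J); omega)
    by_cases hI : Injective I
    · by_cases hJ : Injective J
      · exact hinj y hy I J hI hJ ho
      simp only [Injective, not_forall] at hJ
      obtain ⟨l', l, he, hne⟩ := hJ
      have hg := card_image_update_gt J l l' b hbJ hne he
      have hr := rel2 y (J l) b I (update J l b) l (by
        intro j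
        by_cases hj : j = l
        · simp [hj]
        · simp [hj, hbJ])
      rw [ih _ (hD y hy _ _ (hbJ l)) I (update J l b) (by omega) (by
        refine lt_of_le_of_lt (card_le_card ?_) ho
        intro j
        simp only [mem_filter, mem_univ, true_and]
        rintro ⟨k, hk⟩
        by_cases hj : j = l
        · subst hj; simp [hbI] at hk
        · exact ⟨k, by simpa [hj] using hk⟩)] at hr
      rw [sum_eq_zero] at hr
      · simpa using hr
      intro k _
      split_ifs with hk
      · refine ih y hy _ _ ?_ ?_
        · have := card_image_update_ge I k b hbI
          omega
        · refine lt_of_le_of_lt (card_le_card ?_) ho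
          intro j
          simp only [mem_filter, mem_univ, true_and]
          rintro ⟨k2, hk2⟩
          by_cases hj : j = l
          · exact ⟨k, by rw [hk, hj]⟩
          · by_cases h3 : k2 = k
            · subst h3; simp [hj] at hk2; exact absurd hk2.symm (hbJ j)
            · exact ⟨k2, by simpa [hj, h3] using hk2⟩
      · rfl
    · simp only [Injective, not_forall] at hI
      obtain ⟨k', k, he, hne⟩ := hI
      have hg := card_image_update_gt I k k' b hbI hne he
      have hr := rel1 y (I k) b (update I k b) J k (by
        intro j
        by_cases hj : j = k
        · simp [hj]
        · simp [hj, hbI])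
      rw [ih _ (hD y hy _ _ (hbI k).symm) (update I k b) J (by omega) (by
        refine lt_of_le_of_lt (card_le_card ?_) ho
        intro j
        simp only [mem_filter, mem_univ, true_and]
        rintro ⟨k2, hk⟩
        by_cases hj : k2 = k
        · subst hj; simp at hk; exact absurd hk.symm (hbJ j)
        · exact ⟨k2, by simpa [hj] using hk⟩)] at hr
      rw [sum_eq_zero] at hr
      · simpa using hr.symm
      intro l _
      split_ifs with hl
      · refine ih y hy _ _ ?_ ?_
        · have := card_image_update_ge J l b hbJ
          omega
        · refine lt_of_le_of_lt (card_le_card ?_) ho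
          intro j
          simp only [mem_filter, mem_univ, true_and]
          rintro ⟨k2, hk2⟩
          by_cases hj : j = l
          · exact ⟨k, by rw [hj, hl]⟩
          · by_cases h3 : k2 = k
            · subst h3; simp [hj] at hk2; exact absurd hk2.symm (hbJ j)
            · exact ⟨k2, by simpa [hj, h3] using hk2⟩
      · rfl

lemma inj_update {s : ℕ} (J : Fin s → Fin n) (l : Fin s) (b : Fin n) (hJ : Injective J)
    (hb : ∀ j, J j ≠ b) : Injective (update J l b) := by
  intro x y hxy
  simp only [update_apply] at hxy
  split_ifs at hxy with h1 h2 h2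
  · rw [h1, h2]
  · exact absurd hxy.symm (hb y)
  · exact absurd hxy (hb x)
  · exact hJ hxy

lemma inj_update2 {s : ℕ} (J : Fin s → Fin n) (l l' : Fin s) (b : Fin n) (hJ : Injective J)
    (hb : ∀ j, J j ≠ b) : Injective (update (update J l (J l')) l' b) := by
  intro x y hxy
  simp only [update_apply] at hxy
  have hJ' : ∀ u v, J u = J v → u = v := fun u v h => hJ h
  grind

lemma mainstep (N : Set (Tens n p q)) (hn : p + q ≤ n)
    (hD : ∀ y ∈ N, ∀ a b, a ≠ b → D a b y ∈ N) (hT : ∀ y ∈ N, y ∈ Traceless n p q) (r : ℕ)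
    (hr : 1 ≤ r) (hP : ∀ y ∈ N, ∀ I J, ov I J < r → y (I, J) = 0) (y : Tens n p q) (hy : y ∈ N)
    (I : Fin p → Fin n) (J : Fin q → Fin n) (hI : Injective I) (hJ : Injective J)
    (ho : ov I J ≤ r)
    (hmax : ∀ I' J', Injective I' → Injective J' → ov I' J' ≤ r → |y (I', J')| ≤ |y (I, J)|) :
    y (I, J) = 0 := by
  rcases ho.lt_or_eq with ho | ho
  · exact hP y hy I J ho
  obtain ⟨l, hl⟩ : (univ.filter fun l => ∃ k, I k = J l).Nonempty := by
    rw [← card_pos]; change 0 < ov I J; omega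
  obtain ⟨k, hk⟩ := (mem_filter.1 hl).2
  have hp : 0 < p := k.pos
  have hq : 0 < q := l.pos
  set S := univ.filter fun l => ∃ k, I k = J l with hS
  have hSc : S.card = r := ho
  have hSe : (S.erase l).card < r := by rw [card_erase_of_mem hl]; omega
  have cI : (univ.image I).card = p := by rw [card_image_of_injective _ hI]; simp
  have cJ : (univ.image J).card = q := by rw [card_image_of_injective _ hJ]; simp
  obtain ⟨b, hbI, hbJ⟩ := exists_unused I J (by
    have h1 := card_union_add_card_inter (univ.image I) (univ.image J)
    have h2 : 0 < (univ.image I ∩ univ.image J).card :=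
      card_pos.2 ⟨I k, mem_inter.2 ⟨mem_image_of_mem _ (mem_univ _),
        hk ▸ mem_image_of_mem _ (mem_univ _)⟩⟩
    omega)
  set W := (univ.erase k).image I ∪ (univ.erase l).image J with hW
  have hWc : W.card ≤ p + q - 2 := by
    refine (card_union_le _ _).trans ?_
    have h1 := card_image_le (s := univ.erase k) (f := I)
    have h2 := card_image_le (s := univ.erase l) (f := J)
    rw [card_erase_of_mem (mem_univ _), card_fin] at h1 h2
    omega
  set C := |y (I, J)| with hC
  set G : Fin n → ℚ := fun m => y (update I k m, update J l m) with hG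
  have hsum : ∑ m, G m = 0 := (mem_traceless y).1 (hT y hy) k l I J
  have keyA : ∀ m, m ≠ b → (∀ j, j ≠ l → J j = m → ∃ k', I k' = m) →
      G m = ∑ j, if update I k m j = m then y (update (update I k m) j b, update J l b) else 0 := by
    intro m hmb hm
    have h1 := rel2 y m b (update I k m) (update J l b) l (by
      intro j
      by_cases hj : j = l
      · simp [hj]
      · simp [hj, hbJ])
    rw [hP _ (hD y hy _ _ hmb) _ _ (by
      refine lt_of_le_of_lt (card_le_card ?_) hSe
      intro j
      simp only [mem_filter, mem_univ, true_and, mem_erase, hS]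
      rintro ⟨k2, hk2⟩
      by_cases hj : j = l
      · subst hj
        by_cases h3 : k2 = k
        · subst h3; simp at hk2; exact absurd hk2 hmb
        · simp [h3, hbI] at hk2
      · refine ⟨hj, ?_⟩
        by_cases h3 : k2 = k
        · subst h3
          simp [hj] at hk2
          obtain ⟨k', hk'⟩ := hm j hj hk2.symm
          exact ⟨k', by rw [hk', hk2]⟩
        · exact ⟨k2, by simpa [hj, h3] using hk2⟩)] at h1
    simp only [update_idem] at h1
    simp only [hG]
    linarith
  have keyB : ∀ m, m ≠ b → (∀ j, j ≠ k → I j ≠ m) →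
      G m = ∑ j, if update J l m j = m then y (update I k b, update (update J l m) j b) else 0 := by
    intro m hmb hm
    have h1 := rel1 y m b (update I k b) (update J l m) k (by
      intro j
      by_cases hj : j = k
      · simp [hj]
      · simp [hj, hbI])
    rw [hP _ (hD y hy _ _ hmb.symm) _ _ (by
      refine lt_of_le_of_lt (card_le_card ?_) hSe
      intro j
      simp only [mem_filter, mem_univ, true_and, mem_erase, hS]
      rintro ⟨k2, hk2⟩
      by_cases hj : j = l
      · subst hj
        by_cases h3 : k2 = k
        · subst h3; simp at hk2; exact absurd hk2.symm hmb
        · simp [h3, hm] at hk2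
      · refine ⟨hj, ?_⟩
        by_cases h3 : k2 = k
        · subst h3
          simp [hj] at hk2
          exact absurd hk2.symm (hbJ j)
        · exact ⟨k2, by simpa [hj, h3] using hk2⟩)] at h1
    simp only [update_idem] at h1
    simp only [hG]
    linarith
  -- labels outside `W`
  have hout : ∀ m, m ∉ W → G m = G b := by
    intro m hm
    by_cases hmb : m = b
    · rw [hmb]
    simp only [hW, mem_union, mem_image, mem_erase, mem_univ, not_or, not_exists, not_and,
      and_true] at hm
    rw [keyA m hmb (fun j hj h => absurd h (hm.2 j hj)), sum_eq_single k]
    · simp [hG]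
    · intro j _ hj
      simp [hj, hm.1 j hj]
    · simp
  have haW : J l ∉ W := by
    simp only [hW, mem_union, mem_image, mem_erase, mem_univ, not_or, not_exists, not_and,
      and_true]
    constructor
    · intro j hj h; exact hj (hI (h.trans hk.symm))
    · intro j hj h; exact hj (hJ h)
  have hGa : G (J l) = y (I, J) := by
    simp only [hG, update_eq_self]
    rw [← hk, update_eq_self]
  have hGb : G b = y (I, J) := by rw [← hGa, hout _ haW]
  have hin : ∀ m, m ∈ W → |G m - G b| ≤ C := by
    intro m hm
    have hmb : m ≠ b := by
      rintro rfl
      simp only [hW, mem_union, mem_image] at hm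
      rcases hm with ⟨j, -, hj⟩ | ⟨j, -, hj⟩
      · exact hbI j hj
      · exact hbJ j hj
    by_cases hmI : ∃ k', k' ≠ k ∧ I k' = m
    · obtain ⟨k', hne, rfl⟩ := hmI
      rw [keyA _ hmb (fun _ _ _ => ⟨k', rfl⟩), ← add_sum_erase _ _ (mem_univ k),
        sum_eq_single k']
      · simp only [update_self, if_true, update_idem, update_of_ne hne]
        rw [show y (update I k b, update J l b) = G b from rfl, add_sub_cancel_left]
        refine hmax _ _ (inj_update2 I k k' b hI hbI) (inj_update J l b hJ hbJ) ?_
        refine le_trans (card_le_card ?_) ho.le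
        intro j
        simp only [mem_filter, mem_univ, true_and]
        rintro ⟨k2, hk2⟩
        by_cases hj : j = l
        · exact ⟨k, by rw [hj, hk]⟩
        · simp only [update_apply, hj, if_false] at hk2
          split_ifs at hk2
          · exact absurd hk2.symm (hbJ j)
          · exact ⟨k', hk2⟩
          · exact ⟨k2, hk2⟩
      · intro j hj hj'
        have hj : j ≠ k := by simpa using hj
        rw [update_of_ne hj, if_neg]
        intro h; exact hj' (hI h)
      · simp [hne]
    · push Not at hmI
      obtain ⟨l', hne, rfl⟩ : ∃ l', l' ≠ l ∧ J l' = m := by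
        simp only [hW, mem_union, mem_image, mem_erase, mem_univ, and_true] at hm
        rcases hm with ⟨j, hj, hj'⟩ | h
        · exact absurd hj' (hmI j hj)
        · exact h
      rw [keyB _ hmb hmI, ← add_sum_erase _ _ (mem_univ l), sum_eq_single l']
      · simp only [update_self, if_true, update_idem, update_of_ne hne]
        rw [show y (update I k b, update J l b) = G b from rfl, add_sub_cancel_left]
        refine hmax _ _ (inj_update I k b hI hbI) (inj_update2 J l l' b hJ hbJ) ?_
        have hc : (insert l' (S.erase l)).card ≤ r := (card_insert_le _ _).trans (by omega)
        refine le_trans (card_le_card ?_) hc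
        intro j
        simp only [mem_filter, mem_univ, true_and, mem_insert, mem_erase, hS]
        rintro ⟨k2, hk2⟩
        by_cases hj' : j = l'
        · exact Or.inl hj'
        right
        simp only [update_apply, hj', if_false] at hk2
        split_ifs at hk2 with h1 h2 h3
        · exact absurd hk2.symm hmb
        · exact absurd hk2.symm (hbJ j)
        · exact absurd hk2 (hmI k2 h1)
        · exact ⟨h3, k2, hk2⟩
      · intro j hj hj'
        have hj : j ≠ l := by simpa using hj
        rw [update_of_ne hj, if_neg]
        intro h; exact hj' (hJ h)
      · simp [hne]
  have h1 : ∑ m, (G m - G b) = -(n * G b) := by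
    rw [sum_sub_distrib, hsum]; simp
  have h2 : ∑ m, (G m - G b) = ∑ m ∈ W, (G m - G b) := by
    symm
    apply sum_subset (subset_univ _)
    intro m _ hm
    rw [hout m hm, sub_self]
  have h3 : |∑ m ∈ W, (G m - G b)| ≤ W.card * C := by
    refine (abs_sum_le_sum_abs _ _).trans ?_
    refine (sum_le_card_nsmul W _ C hin).trans ?_
    simp
  rw [← h2, h1, abs_neg, abs_mul, hGb, Nat.abs_cast] at h3
  have h4 : (W.card : ℚ) + 1 ≤ n := by
    have : W.card + 1 ≤ n := by omega
    exact_mod_cast this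
  have h5 : 0 ≤ C := abs_nonneg _
  have h6 : C = 0 := by
    have : ((W.card : ℚ) + 1) * C ≤ n * C := mul_le_mul_of_nonneg_right h4 h5
    rw [← hC] at h3
    linarith
  exact abs_eq_zero.1 h6

lemma allzero (N : Set (Tens n p q)) (hn : p + q ≤ n)
    (hD : ∀ y ∈ N, ∀ a b, a ≠ b → D a b y ∈ N) (hT : ∀ y ∈ N, y ∈ Traceless n p q)
    (h0 : ∀ y ∈ N, ∀ I J, Injective I → Injective J → (∀ k l, I k ≠ J l) → y (I, J) = 0) :
    ∀ r, ∀ y ∈ N, ∀ I J, ov I J < r → y (I, J) = 0 := by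
  intro r
  induction r with
  | zero => intro y _ I J h; omega
  | succ r ih =>
    intro y hy I J ho
    refine reduce N hn hD (r + 1) ?_ (p + q) y hy I J (by omega) ho
    clear! y I J
    intro y hy I J hI hJ ho
    rcases Nat.eq_zero_or_pos r with rfl | hr
    · refine h0 y hy I J hI hJ ?_
      intro k l hkl
      have : ov I J = 0 := by omega
      rw [ov, card_eq_zero, filter_eq_empty_iff] at this
      exact this (mem_univ l) ⟨k, hkl⟩
    · classical
      obtain ⟨⟨I1, J1⟩, hm, hmax⟩ := exists_max_image
        (univ.filter fun IJ : (Fin p → Fin n) × (Fin q → Fin n) =>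
          Injective IJ.1 ∧ Injective IJ.2 ∧ ov IJ.1 IJ.2 ≤ r) (fun IJ => |y IJ|)
        ⟨(I, J), by simp [hI, hJ]; omega⟩
      simp only [mem_filter, mem_univ, true_and, Prod.forall] at hm hmax
      have hz := mainstep N hn hD hT r hr ih y hy I1 J1 hm.1 hm.2.1 hm.2.2
        (fun I' J' h1 h2 h3 => hmax I' J' ⟨h1, h2, h3⟩)
      have := hmax I J ⟨hI, hJ, by omega⟩
      rw [hz, abs_zero] at this
      exact abs_nonpos_iff.1 this

/-- Labels of the vector slots of `epq`. -/
def al (h : p + q ≤ n) (k : Fin p) : Fin n := ⟨k, by omega⟩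

/-- Labels of the dual slots of `epq`. -/
def be (h : p + q ≤ n) (l : Fin q) : Fin n := ⟨n - 1 - l, by omega⟩

lemma al_ne_be (h : p + q ≤ n) (k : Fin p) (l : Fin q) : al h k ≠ be h l := by
  simp only [al, be, ne_eq, Fin.mk.injEq]; omega

lemma al_inj (h : p + q ≤ n) : Injective (al h : Fin p → Fin n) := by
  intro a b hab
  simp only [al, Fin.mk.injEq] at hab; omega

lemma be_inj (h : p + q ≤ n) : Injective (be h : Fin q → Fin n) := by
  intro a b hab
  simp only [be, Fin.mk.injEq] at hab; omega

/-- Coordinates of a pure tensor built from two matrices. -/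
def pure' (h : p + q ≤ n) (A B : Matrix (Fin n) (Fin n) ℚ) : Tens n p q := fun IJ =>
  (∏ k, A (IJ.1 k) (al h k)) * ∏ l, B (be h l) (IJ.2 l)

lemma rho_epq (h : p + q ≤ n) (g : GL (Fin n) ℚ) :
    rho n p q g (epq n p q) = pure' h (g : Matrix (Fin n) (Fin n) ℚ)
      ((g⁻¹ : GL (Fin n) ℚ) : Matrix (Fin n) (Fin n) ℚ) := by
  ext IJ
  simp only [rho, LinearMap.pi_apply, LinearMap.sum_apply, LinearMap.smul_apply,
    LinearMap.proj_apply, smul_eq_mul]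
  rw [sum_eq_single (al h, be h)]
  · simp [epq, pure', al, be]
  · intro KL _ hne
    rw [epq, if_neg, mul_zero]
    rintro ⟨h1, h2⟩
    apply hne
    ext x
    · exact h1 x
    · exact h2 x
  · simp

lemma pure_traceless (h : p + q ≤ n) (A B : Matrix (Fin n) (Fin n) ℚ) (hBA : B * A = 1) :
    pure' h A B ∈ Traceless n p q := by
  rw [mem_traceless]
  intro k l I J
  have h1 : ∀ m, pure' h A B (update I k m, update J l m) =
      ((∏ j ∈ univ.erase k, A (I j) (al h j)) * ∏ j ∈ univ.erase l, B (be h j) (J j)) *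
        (B (be h l) m * A m (al h k)) := by
    intro m
    simp only [pure']
    rw [← mul_prod_erase _ _ (mem_univ k), ← mul_prod_erase univ _ (mem_univ l)]
    have e1 : ∏ j ∈ univ.erase k, A (update I k m j) (al h j) =
        ∏ j ∈ univ.erase k, A (I j) (al h j) :=
      prod_congr rfl fun j hj => by rw [update_of_ne (by simpa using hj)]
    have e2 : ∏ j ∈ univ.erase l, B (be h j) (update J l m j) =
        ∏ j ∈ univ.erase l, B (be h j) (J j) :=
      prod_congr rfl fun j hj => by rw [update_of_ne (by simpa using hj)]
    rw [e1, e2]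
    simp only [update_self]
    ring
  simp only [h1]
  rw [← mul_sum, ← Matrix.mul_apply, hBA, Matrix.one_apply_ne (al_ne_be h k l).symm, mul_zero]

lemma sum_shift {s : ℕ} (k : Fin s) (a b : Fin n) (F : (Fin s → Fin n) → (Fin s → Fin n) → ℚ) :
    (∑ I, if I k = b then F (update I k a) I else 0) =
      ∑ I, if I k = a then F I (update I k b) else 0 := by
  rw [← sum_filter, ← sum_filter]
  refine sum_nbij' (fun I => update I k a) (fun I => update I k b) ?_ ?_ ?_ ?_ ?_
  · simp
  · simp
  · intro I hI
    have : I k = b := by simpa using hI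
    simp [← this]
  · intro I hI
    have : I k = a := by simpa using hI
    simp [← this]
  · intro I hI
    have : I k = b := by simpa using hI
    simp [← this]

lemma oneside {s : ℕ} (M : Fin s → Fin n → ℚ) (a b : Fin n) (f : (Fin s → Fin n) → ℚ) :
    ∑ I, (∑ k, (∏ j ∈ univ.erase k, M j (I j)) * (if I k = b then M k a else 0)) * f I =
      ∑ I, (∏ j, M j (I j)) * ∑ k, if I k = a then f (update I k b) else 0 := by
  simp only [sum_mul, mul_sum]
  rw [sum_comm, sum_comm (s := univ (α := Fin s → Fin n))]
  refine sum_congr rfl fun k _ => ?_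
  have h1 := sum_shift k a b (fun I I' => (∏ j, M j (I j)) * f I')
  simp only [mul_ite, mul_zero]
  rw [← h1]
  refine sum_congr rfl fun I _ => ?_
  by_cases hI : I k = b
  · simp only [hI, if_true]
    rw [← mul_prod_erase _ _ (mem_univ k), update_self, mul_comm (M k a)]
    congr 2
    exact prod_congr rfl fun j hj => by rw [update_of_ne (by simpa using hj)]
  · simp [hI]

/-- The elementary transvection as an element of the general linear group. -/
def tv (a b : Fin n) (hab : a ≠ b) (t : ℚ) : GL (Fin n) ℚ where
  val := Matrix.transvection b a t
  inv := Matrix.transvection b a (-t)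
  val_inv := by rw [Matrix.transvection_mul_transvection_same (h := hab.symm)]; simp
  inv_val := by rw [Matrix.transvection_mul_transvection_same (h := hab.symm)]; simp

open Polynomial in
lemma D_orth (h : p + q ≤ n) (a b : Fin n) (hab : a ≠ b) (y : Tens n p q)
    (hy : ∀ g : GL (Fin n) ℚ, ∑ IJ, rho n p q g (epq n p q) IJ * y IJ = 0) (g : GL (Fin n) ℚ) :
    ∑ IJ, rho n p q g (epq n p q) IJ * D a b y IJ = 0 := by
  set A : Matrix (Fin n) (Fin n) ℚ := (g : Matrix (Fin n) (Fin n) ℚ) with hA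
  set B : Matrix (Fin n) (Fin n) ℚ := ((g⁻¹ : GL (Fin n) ℚ) : Matrix (Fin n) (Fin n) ℚ) with hB
  -- the polynomial in the parameter of the transvection
  let PA : (Fin p → Fin n) → Fin p → ℚ[X] := fun I k =>
    C (A (I k) (al h k)) + X * C (if I k = b then A a (al h k) else 0)
  let PB : (Fin q → Fin n) → Fin q → ℚ[X] := fun J l =>
    C (B (be h l) (J l)) - X * C (if J l = a then B (be h l) b else 0)
  let P : ℚ[X] := ∑ IJ : (Fin p → Fin n) × (Fin q → Fin n),
    (∏ k, PA IJ.1 k) * (∏ l, PB IJ.2 l) * C (y IJ)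
  have hP : P = 0 := by
    apply Polynomial.funext
    intro t
    rw [eval_zero, ← hy (tv a b hab t * g), rho_epq h]
    simp only [P, eval_finsetSum, eval_mul, eval_prod, eval_C]
    refine sum_congr rfl fun IJ _ => ?_
    congr 1
    simp only [pure']
    congr 1
    · refine prod_congr rfl fun k _ => ?_
      simp only [PA, tv, Units.val_mul, Matrix.transvection, add_mul, one_mul, Matrix.add_apply,
        eval_add, eval_mul, eval_X, eval_C]
      congr 1
      by_cases hk : IJ.1 k = b
      · simp [hk, hA]
      · simp [hk, Matrix.single_mul_apply_of_ne]
    · refine prod_congr rfl fun l _ => ?_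
      simp only [PB, tv, mul_inv_rev, Units.val_mul, eval_sub, eval_mul, eval_X, eval_C]
      rw [← hB]
      change _ = (B * Matrix.transvection b a (-t)) (be h l) (IJ.2 l)
      simp only [Matrix.transvection, mul_add, mul_one, Matrix.add_apply]
      rw [sub_eq_add_neg]
      congr 1
      by_cases hk : IJ.2 l = a
      · simp [hk, mul_comm]
      · simp [hk, Matrix.mul_single_apply_of_ne]
  have hd : (derivative P).eval 0 = 0 := by rw [hP]; simp
  simp only [P, derivative_sum, derivative_mul, derivative_prod_finset, derivative_C, mul_zero,
    add_zero, eval_finsetSum, eval_mul, eval_add, eval_prod, eval_C, PA, PB, derivative_X,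
    eval_X, zero_mul, one_mul, zero_add, derivative_sub, eval_sub, sub_zero, zero_sub,
    derivative_add, eval_neg] at hd
  rw [rho_epq h, ← hA, ← hB]
  simp only [D, pure']
  have e1 : ∀ J : Fin q → Fin n, _ := fun J =>
    oneside (fun k m => A m (al h k)) a b (fun I => (∏ l, B (be h l) (J l)) * y (I, J))
  have e2 : ∀ I : Fin p → Fin n, _ := fun I =>
    oneside (fun l m => B (be h l) m) b a (fun J => (∏ k, A (I k) (al h k)) * y (I, J))
  have e1' := sum_congr (rfl : (univ : Finset (Fin q → Fin n)) = univ) fun J _ => e1 J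
  have e2' := sum_congr (rfl : (univ : Finset (Fin p → Fin n)) = univ) fun I _ => e2 I
  rw [sum_comm, sum_comm (s := univ (α := Fin q → Fin n))] at e1'
  refine Eq.trans ?_ hd
  rw [Fintype.sum_prod_type, Fintype.sum_prod_type]
  have hsub := congrArg₂ (· - ·) e1' e2'
  simp only [← sum_sub_distrib] at hsub
  refine Eq.trans ?_ (hsub.symm.trans ?_)
  · refine sum_congr rfl fun I _ => sum_congr rfl fun J _ => ?_
    have u1 : (∑ k, if I k = a then (∏ l, B (be h l) (J l)) * y (update I k b, J) else 0) =
        (∏ l, B (be h l) (J l)) * ∑ k, if I k = a then y (update I k b, J) else 0 := by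
      rw [mul_sum]; simp only [mul_ite, mul_zero]
    have u2 : (∑ l, if J l = b then (∏ k, A (I k) (al h k)) * y (I, update J l a) else 0) =
        (∏ k, A (I k) (al h k)) * ∑ l, if J l = b then y (I, update J l a) else 0 := by
      rw [mul_sum]; simp only [mul_ite, mul_zero]
    rw [u1, u2]
    ring
  · refine sum_congr rfl fun I _ => sum_congr rfl fun J _ => ?_
    simp only [mul_neg, sum_neg_distrib]
    ring

lemma perm_orth (h : p + q ≤ n) (y : Tens n p q)
    (hy : ∀ g : GL (Fin n) ℚ, ∑ IJ, rho n p q g (epq n p q) IJ * y IJ = 0)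
    (I : Fin p → Fin n) (J : Fin q → Fin n) (hI : Injective I) (hJ : Injective J)
    (hIJ : ∀ k l, I k ≠ J l) : y (I, J) = 0 := by
  classical
  obtain ⟨σ, hσ⟩ : ∃ σ : Equiv.Perm (Fin n), ∀ s : Fin p ⊕ Fin q,
      σ (Sum.elim (al h) (be h) s) = Sum.elim I J s := by
    have i1 : Injective (Sum.elim (al h) (be h) : Fin p ⊕ Fin q → Fin n) :=
      (al_inj h).sumElim (be_inj h) (al_ne_be h)
    have i2 : Injective (Sum.elim I J) := hI.sumElim hJ hIJ
    let e := (Equiv.ofInjective _ i1).symm.trans (Equiv.ofInjective _ i2)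
    refine ⟨e.extendSubtype, fun s => ?_⟩
    rw [Equiv.extendSubtype_apply_of_mem e _ ⟨s, rfl⟩]
    simp only [e, Equiv.trans_apply]
    have : (⟨Sum.elim (al h) (be h) s, ⟨s, rfl⟩⟩ : Set.range (Sum.elim (al h) (be h))) =
      Equiv.ofInjective _ i1 s := rfl
    rw [this, Equiv.symm_apply_apply]
    rfl
  have h1 : ∀ k, σ (al h k) = I k := fun k => hσ (Sum.inl k)
  have h2 : ∀ l, σ (be h l) = J l := fun l => hσ (Sum.inr l)
  let A : Matrix (Fin n) (Fin n) ℚ := fun i j => if i = σ j then 1 else 0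
  let B : Matrix (Fin n) (Fin n) ℚ := fun i j => if σ i = j then 1 else 0
  have hBA : B * A = 1 := by
    ext i j
    rw [Matrix.mul_apply]
    simp [A, B, Matrix.one_apply]
  let g : GL (Fin n) ℚ := ⟨A, B, mul_eq_one_comm.1 hBA, hBA⟩
  have hg := hy g
  rw [rho_epq h, sum_eq_single (I, J)] at hg
  · have : pure' h (g : Matrix (Fin n) (Fin n) ℚ)
      ((g⁻¹ : GL (Fin n) ℚ) : Matrix (Fin n) (Fin n) ℚ) (I, J) = 1 := by
      change pure' h A B (I, J) = 1
      simp [pure', A, B, h1, h2]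
    rwa [this, one_mul] at hg
  · rintro ⟨I', J'⟩ _ hne
    change pure' h A B (I', J') * _ = 0
    by_contra hc
    apply hne
    have hc := left_ne_zero_of_mul hc
    simp only [pure'] at hc
    have c1 := left_ne_zero_of_mul hc
    have c2 := right_ne_zero_of_mul hc
    rw [prod_ne_zero_iff] at c1 c2
    rw [Prod.mk.injEq]
    constructor
    · funext k
      by_contra hk
      exact c1 k (mem_univ _) (by simp [A, h1, hk])
    · funext l
      by_contra hk
      exact c2 l (mem_univ _) (by simp [B, h2, Ne.symm hk])
  · simp

lemma orth_zero (h : p + q ≤ n) (y : Tens n p q) (hT : y ∈ Traceless n p q)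
    (hy : ∀ g : GL (Fin n) ℚ, ∑ IJ, rho n p q g (epq n p q) IJ * y IJ = 0) : y = 0 := by
  have key := allzero {y : Tens n p q | y ∈ Traceless n p q ∧
    ∀ g : GL (Fin n) ℚ, ∑ IJ, rho n p q g (epq n p q) IJ * y IJ = 0} h
    (fun y hy a b hab => ⟨D_traceless a b y hy.1, D_orth h a b hab y hy.2⟩)
    (fun y hy => hy.1) (fun y hy => perm_orth h y hy.2)
  ext IJ
  exact key (ov IJ.1 IJ.2 + 1) y ⟨hT, hy⟩ IJ.1 IJ.2 (Nat.lt_succ_self _)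

end TL

theorem stmt_4 (n p q : ℕ) (h : p + q ≤ n) :
    Submodule.span ℚ {x : Tens n p q | ∃ g : GL (Fin n) ℚ, x = rho n p q g (epq n p q)}
      = Traceless n p q := by
  set M := Submodule.span ℚ {x : Tens n p q | ∃ g : GL (Fin n) ℚ, x = rho n p q g (epq n p q)}
    with hM
  have hle : M ≤ Traceless n p q := by
    rw [hM, Submodule.span_le]
    rintro x ⟨g, rfl⟩
    rw [TL.rho_epq h]
    exact TL.pure_traceless h _ _ (by rw [← Units.val_mul]; simp)
  apply le_antisymm hle
  let Bf : LinearMap.BilinForm ℚ (Tens n p q) := dotProductBilin ℚ ℚ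
  have hBf : ∀ x y, Bf x y = ∑ i, x i * y i := fun x y => rfl
  have hsymm : Bf.IsRefl := by
    intro x y hxy
    rw [hBf] at *
    rw [← hxy]
    exact Finset.sum_congr rfl fun _ _ => mul_comm _ _
  have hnd : (Bf.restrict M).Nondegenerate := by
    refine LinearMap.BilinForm.nondegenerate_restrict_of_disjoint_orthogonal _ hsymm ?_
    rw [Submodule.disjoint_def]
    intro x hx hx'
    have h0 : ∑ i, x i * x i = 0 := hx' x hx
    funext i
    have := (Finset.sum_eq_zero_iff_of_nonneg (fun i _ => mul_self_nonneg (x i))).1 h0 i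
      (Finset.mem_univ i)
    exact mul_self_eq_zero.1 this
  have hc := LinearMap.BilinForm.isCompl_orthogonal_of_restrict_nondegenerate hsymm hnd
  intro x hx
  obtain ⟨m, hm, y, hy, rfl⟩ := Submodule.mem_sup.1
    (show x ∈ M ⊔ Bf.orthogonal M by rw [hc.sup_eq_top]; trivial)
  have hyT : y ∈ Traceless n p q := by
    have := Submodule.sub_mem _ hx (hle hm)
    simpa using this
  have : y = 0 := TL.orth_zero h y hyT fun g => hy _ (Submodule.subset_span ⟨g, rfl⟩)
  rw [this, add_zero]
  exact hm
end

section
/- Let U = (Λ²H)⊗H* for H = ℚ^n and let F_* = ⊕_i F_i : Λ*U → S*(U_*) be the graded GL(n,ℚ)-homomorphism defined componentwise by the combinations of tree and wheel contraction maps F_{(μ,ν)} (summed over pairs of partitions (μ,ν) of total size i). Then F_* is a map of coalgebras: (F_* ⊗ F_*)∘Δ^U_* = Δ∘F_*, where Δ^U_* is the standard shuffle comultiplication on the exterior algebra Λ*U and Δ is the shuffle comultiplication on the graded-symmetric algebra S*(U_*). -/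
/-!
STATEMENT 11.  `H = ℚⁿ`, `U = Λ²H ⊗ H*`, `U_m = Λ^{m+1}H ⊗ H* = U^tree_m ⊕ U^wheel_m`
for `m ≥ 1`, and `S*(U_*)` the graded-symmetric algebra of `U_* = ⊕_{m≥1} U_m` with its
shuffle comultiplication `Δ`.  The graded map `F_* = ⊕_i F_i : Λ*U → S*(U_*)` has
components `F_{(μ,ν)}` (one for each pair of partitions `(μ,ν)` of total size `i`),
the composite of the antisymmetrization `ι_i : Λ^iU → (H^{⊗2}⊗H*)^{⊗i}` with a
tensor product of tree contractions `c^tree_{μ_j}` (normalized by `1/k'_j!`) and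
wheel contractions `c^wheel_{ν_j}` (normalized by `1/k''_j!`).  The claim: `F_*` is
a map of coalgebras, `(F_*⊗F_*) ∘ Δ^U_* = Δ ∘ F_*`, where `Δ^U_*` is the shuffle
comultiplication of the exterior coalgebra `Λ*U`.

Concretely: `H ⊗ H ⊗ H*` is modelled in coordinates as `MT n`, elements of `U` as
antisymmetric coordinate tensors, `U_m` inside `E := (ΛH) ⊗ H*`; `c^tree = π ∘ c`
where `π` is the projection of `Λ^{m+1}H ⊗ H*` onto `U^tree` along
`U^wheel = im(ε)`, `ε(ω) = Σ_j (ω∧e_j)⊗e_j*`; wheel values are embedded into `U_m`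
via `ε`.  The target `S*(U_*)` is axiomatized as in Statement 10 (an algebra with
structure maps `ι_m : U_m → S` and `Δ` given by the graded shuffle formula), and
the claim is verified on tuples `u : Fin i → U`.
-/

open scoped TensorProduct

abbrev MT (n : ℕ) : Type := (Fin n × Fin n × Fin n) → ℚ

def bv {n : ℕ} (a : Fin n) : Fin n → ℚ := Pi.single a 1

/-- The ambient space `E = (ΛH) ⊗ H*` containing every `U_m = Λ^{m+1}H ⊗ H*`. -/
abbrev EA (n : ℕ) : Type := ExteriorAlgebra ℚ (Fin n → ℚ) ⊗[ℚ] (Fin n → ℚ)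

noncomputable def wedge (n i : ℕ) (v : Fin i → Fin n) : ExteriorAlgebra ℚ (Fin n → ℚ) :=
  ((List.finRange i).map fun j => ExteriorAlgebra.ι ℚ (bv (v j))).prod

noncomputable def wedgeb (n i : ℕ) (v : Fin i → Fin n) (w : Fin n) :
    ExteriorAlgebra ℚ (Fin n → ℚ) :=
  (((List.finRange i).map fun j => ExteriorAlgebra.ι ℚ (bv (v j))) ++
    [ExteriorAlgebra.ι ℚ (bv w)]).prod

/-- `ε : Λ^m H → Λ^{m+1}H ⊗ H*`, `ω ↦ Σ_j (ω ∧ e_j) ⊗ e_j*`; its image is `U^wheel`. -/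
noncomputable def eps (n : ℕ) : ExteriorAlgebra ℚ (Fin n → ℚ) →ₗ[ℚ] EA n :=
  ∑ j : Fin n,
    (TensorProduct.mk ℚ (ExteriorAlgebra ℚ (Fin n → ℚ)) (Fin n → ℚ)).flip (bv j) ∘ₗ
      LinearMap.mulRight ℚ (ExteriorAlgebra.ι ℚ (bv j))

/-- The value of the contraction `c_s` on a pure tensor `v_1 ⊗ ⋯ ⊗ v_s` of elements
of `H ⊗ H ⊗ H*` (in coordinates):
`⊗_j (a_j⊗b_j⊗d_j*) ↦ (∏_{j=2}^s d_j*(b_{j-1})) (a_1∧⋯∧a_s∧b_s) ⊗ d_1*`. -/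
noncomputable def ctreeT (n s : ℕ) (hs : 0 < s) (v : Fin s → MT n) : EA n :=
  ∑ K : Fin s → Fin n × Fin n × Fin n,
    ((∏ j : Fin s, v j (K j)) *
      ∏ j : Fin s,
        (if hj : (j : ℕ) = 0 then (1:ℚ)
         else if (K j).2.2 = (K (⟨(j : ℕ) - 1, by omega⟩ : Fin s)).2.1 then 1 else 0)) •
      (wedgeb n s (fun j => (K j).1) ((K (⟨s - 1, by omega⟩ : Fin s)).2.1) ⊗ₜ[ℚ]
        bv ((K (⟨0, hs⟩ : Fin s)).2.2))

/-- The value of the wheel contraction `c^wheel_s` on a pure tensor (in coordinates):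
`⊗_j (a_j⊗b_j⊗d_j*) ↦ (∏_j d_j*(b_{j-1})) a_1∧⋯∧a_s` with the cyclic convention. -/
noncomputable def cwheelT (n s : ℕ) (v : Fin s → MT n) :
    ExteriorAlgebra ℚ (Fin n → ℚ) :=
  ∑ K : Fin s → Fin n × Fin n × Fin n,
    ((∏ j : Fin s, v j (K j)) *
      ∏ j : Fin s,
        (if (K j).2.2 =
            (K (⟨((j : ℕ) + s - 1) % s,
                Nat.mod_lt _ (lt_of_le_of_lt (Nat.zero_le _) j.isLt)⟩ : Fin s)).2.1
         then (1:ℚ) else 0)) •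
      wedge n s fun j => (K j).1

-- Koszul sign and shuffles, as in Statement 10.
open Classical in
noncomputable def koszulSign (k : ℕ) (d : Fin k → ℕ) (σ : Equiv.Perm (Fin k)) : ℚ :=
  ∏ p ∈ Finset.univ.filter (fun p : Fin k × Fin k => p.1 < p.2 ∧ σ p.2 < σ p.1),
    ((-1 : ℚ)) ^ (d (σ p.1) * d (σ p.2))

open Classical in
noncomputable def shuffles (k p : ℕ) : Finset (Equiv.Perm (Fin k)) :=
  Finset.univ.filter fun σ =>
    (∀ a b : Fin k, a < b → (b : ℕ) < p → σ a < σ b) ∧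
    (∀ a b : Fin k, a < b → p ≤ (a : ℕ) → σ a < σ b)

/-- A model of the graded-symmetric algebra `S*(U_*)` (cf. Statement 10): the graded
piece `U_m` is realized inside `E = (ΛH) ⊗ H*`. -/
structure SymModel (n : ℕ) where
  S : Type
  [ringS : Ring S]
  [algS : Algebra ℚ S]
  ι : (m : ℕ) → EA n →ₗ[ℚ] S
  comm : ∀ (i j : ℕ) (x y : EA n),
    ι j y * ι i x = ((-1 : ℚ)) ^ (i * j) • (ι i x * ι j y)
  span_top : Submodule.span ℚ
    {s : S | ∃ (k : ℕ) (d : Fin k → ℕ) (x : Fin k → EA n),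
      s = ((List.finRange k).map fun m => ι (d m) (x m)).prod} = ⊤
  Δ : S →ₗ[ℚ] S ⊗[ℚ] S
  Δ_spec : ∀ (k : ℕ) (d : Fin k → ℕ) (x : Fin k → EA n),
    Δ (((List.finRange k).map fun m => ι (d m) (x m)).prod) =
      ∑ p ∈ Finset.range (k + 1), ∑ σ ∈ shuffles k p,
        koszulSign k d σ •
          ((((List.finRange k).take p).map fun m => ι (d (σ m)) (x (σ m))).prod
            ⊗ₜ[ℚ]
           (((List.finRange k).drop p).map fun m => ι (d (σ m)) (x (σ m))).prod)

attribute [instance] SymModel.ringS SymModel.algS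

/-- The ordered list of blocks of the component `F_{(μ,ν)}`: tree blocks of sizes
`μ_1 ≥ μ_2 ≥ ⋯` (marked `true`), then wheel blocks of sizes `ν_1 ≥ ν_2 ≥ ⋯`
(marked `false`), given multiplicity functions `m₁, m₂` for `μ, ν`. -/
def blockList (i : ℕ) (m₁ m₂ : Fin (i + 1) → Fin (i + 1)) : List (ℕ × Bool) :=
  ((List.range (i + 1)).reverse.flatMap fun k =>
    if h : k < i + 1 then List.replicate ((m₁ ⟨k, h⟩ : ℕ)) (k, true) else []) ++
  ((List.range (i + 1)).reverse.flatMap fun k =>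
    if h : k < i + 1 then List.replicate ((m₂ ⟨k, h⟩ : ℕ)) (k, false) else [])

/-- `(m₁, m₂)` encodes a pair of partitions of total size `i` (all parts positive). -/
def validPP (i : ℕ) (pp : (Fin (i + 1) → Fin (i + 1)) × (Fin (i + 1) → Fin (i + 1))) :
    Prop :=
  (pp.1 0 : ℕ) = 0 ∧ (pp.2 0 : ℕ) = 0 ∧
    (∑ k : Fin (i + 1), (k : ℕ) * ((pp.1 k : ℕ) + (pp.2 k : ℕ))) = i

/-- The normalization `∏_j 1/(k'_j! k''_j!)`. -/
noncomputable def normPP (i : ℕ)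
    (pp : (Fin (i + 1) → Fin (i + 1)) × (Fin (i + 1) → Fin (i + 1))) : ℚ :=
  ∏ k : Fin (i + 1),
    (1 / ((Nat.factorial (pp.1 k) : ℚ) * (Nat.factorial (pp.2 k) : ℚ)))

/-- The product, in the model `C` of `S*(U_*)`, of the contraction values of the
consecutive blocks of a (permuted) tuple `w : ℕ → H⊗H⊗H*`:  a tree block of size
`s` contributes `ι_s (π (c_s(…)))` and a wheel block `ι_s (ε (c^wheel_s(…)))`. -/
noncomputable def blockProd (n : ℕ) (C : SymModel n) (πt : EA n →ₗ[ℚ] EA n) :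
    List (ℕ × Bool) → ℕ → (ℕ → MT n) → C.S
  | [], _, _ => 1
  | (s, b) :: rest, off, w =>
      (if hs : 0 < s then
        (if b then C.ι s (πt (ctreeT n s hs (fun t => w (off + (t : ℕ)))))
         else C.ι s (eps n (cwheelT n s (fun t => w (off + (t : ℕ))))))
       else 1) * blockProd n C πt rest (off + s) w

open Classical in
/-- `F_i` evaluated on the wedge `u_0 ∧ u_1 ∧ ⋯`:
`F_i = Σ_{(μ,ν)⊢i} F_{(μ,ν)}`, where `F_{(μ,ν)}` is the normalized sum over all
permutations (the antisymmetrization `ι_i`) of the blockwise contraction values. -/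
noncomputable def Fmap (n : ℕ) (C : SymModel n) (πt : EA n →ₗ[ℚ] EA n) (i : ℕ)
    (u : Fin i → MT n) : C.S :=
  ∑ pp ∈ Finset.univ.filter (validPP i),
    normPP i pp •
      ∑ σ : Equiv.Perm (Fin i),
        ((Equiv.Perm.sign σ : ℤ) : ℚ) •
          blockProd n C πt (blockList i pp.1 pp.2) 0
            (fun t => if h : t < i then u (σ ⟨t, h⟩) else 0)

/-! ### Shuffles -/

def blkPerm {p q : ℕ} (α : Equiv.Perm (Fin p)) (γ : Equiv.Perm (Fin q)) :
    Equiv.Perm (Fin (p + q)) :=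
  finSumFinEquiv.permCongr (Equiv.Perm.sumCongr α γ)

lemma blkPerm_castAdd {p q : ℕ} (α : Equiv.Perm (Fin p)) (γ : Equiv.Perm (Fin q)) (j : Fin p) :
    blkPerm α γ (Fin.castAdd q j) = Fin.castAdd q (α j) := by
  simp [blkPerm, Equiv.permCongr_apply]

lemma blkPerm_natAdd {p q : ℕ} (α : Equiv.Perm (Fin p)) (γ : Equiv.Perm (Fin q)) (j : Fin q) :
    blkPerm α γ (Fin.natAdd p j) = Fin.natAdd p (γ j) := by
  simp [blkPerm, Equiv.permCongr_apply]

lemma sign_blkPerm {p q : ℕ} (α : Equiv.Perm (Fin p)) (γ : Equiv.Perm (Fin q)) :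
    Equiv.Perm.sign (blkPerm α γ) = Equiv.Perm.sign α * Equiv.Perm.sign γ := by
  simp [blkPerm, Equiv.Perm.sign_sumCongr]

lemma mem_shuffles_iff {p q : ℕ} (τ : Equiv.Perm (Fin (p + q))) :
    τ ∈ shuffles (p + q) p ↔ StrictMono (fun j : Fin p => τ (Fin.castAdd q j)) ∧
      StrictMono (fun j : Fin q => τ (Fin.natAdd p j)) := by
  simp only [shuffles, Finset.mem_filter, Finset.mem_univ, true_and]
  constructor
  · rintro ⟨h1, h2⟩
    exact ⟨fun a b hab => h1 _ _ hab (by simp), fun a b hab => h2 _ _ (by simpa using hab) (by simp)⟩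
  · rintro ⟨h1, h2⟩
    refine ⟨fun a b hab hb => ?_, fun a b hab ha => ?_⟩
    · have hab' : (a : ℕ) < b := hab
      exact @h1 ⟨a, by omega⟩ ⟨b, hb⟩ hab
    · have hab' : (a : ℕ) < b := hab
      have := @h2 ⟨a - p, by omega⟩ ⟨b - p, by omega⟩ (by simp; omega)
      have e1 : Fin.natAdd p (⟨a - p, by omega⟩ : Fin q) = a := by ext; simp; omega
      have e2 : Fin.natAdd p (⟨b - p, by omega⟩ : Fin q) = b := by ext; simp; omega
      simpa only [e1, e2] using this

lemma perm_eq_of_strictMono {p : ℕ} {A : Type*} [LinearOrder A] (f g : Fin p → A) (hf : StrictMono f)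
    (hg : StrictMono g) (α α' : Equiv.Perm (Fin p)) (h : ∀ j, f (α j) = g (α' j)) :
    f = g ∧ α = α' := by
  have hr : Set.range f = Set.range g := by
    ext x; constructor
    · rintro ⟨j, rfl⟩; exact ⟨α' (α.symm j), by rw [← h]; simp⟩
    · rintro ⟨j, rfl⟩; exact ⟨α (α'.symm j), by rw [h]; simp⟩
  have hfg : f = g := (hf.range_inj hg).1 hr
  refine ⟨hfg, ?_⟩
  subst hfg
  ext j
  rw [hf.injective (h j)]

lemma blkPerm_ext {p q : ℕ} {σ τ : Equiv.Perm (Fin (p + q))}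
    (h1 : ∀ j, σ (Fin.castAdd q j) = τ (Fin.castAdd q j))
    (h2 : ∀ j, σ (Fin.natAdd p j) = τ (Fin.natAdd p j)) : σ = τ := by
  apply Equiv.ext
  intro j
  exact Fin.addCases h1 h2 j

lemma sum_perm_shuffles {M : Type*} [AddCommMonoid M] (p q : ℕ)
    (H : Equiv.Perm (Fin (p + q)) → M) :
    ∑ σ, H σ = ∑ τ ∈ shuffles (p + q) p, ∑ α : Equiv.Perm (Fin p), ∑ γ : Equiv.Perm (Fin q),
      H (τ * blkPerm α γ) := by
  symm
  simp_rw [← Finset.sum_product']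
  refine Finset.sum_bij (fun x _ => x.1 * blkPerm x.2.1 x.2.2) (fun _ _ => Finset.mem_univ _) ?_ ?_ ?_
  · rintro ⟨τ, α, γ⟩ h ⟨τ', α', γ'⟩ h' heq
    simp only [Finset.mem_product, Finset.mem_univ, and_true, mem_shuffles_iff] at h h'
    have e1 := perm_eq_of_strictMono _ _ h.1 h'.1 α α' (fun j => by
      have := congrArg (fun s : Equiv.Perm (Fin (p + q)) => s (Fin.castAdd q j)) heq
      simpa [blkPerm_castAdd] using this)
    have e2 := perm_eq_of_strictMono _ _ h.2 h'.2 γ γ' (fun j => by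
      have := congrArg (fun s : Equiv.Perm (Fin (p + q)) => s (Fin.natAdd p j)) heq
      simpa [blkPerm_natAdd] using this)
    have : τ = τ' := blkPerm_ext (fun j => congrFun e1.1 j) (fun j => congrFun e2.1 j)
    rw [this, e1.2, e2.2]
  · intro σ _
    set α := Tuple.sort (fun j : Fin p => σ (Fin.castAdd q j)) with hα
    set γ := Tuple.sort (fun j : Fin q => σ (Fin.natAdd p j)) with hγ
    refine ⟨(σ * blkPerm α γ, α⁻¹, γ⁻¹), ?_, ?_⟩
    · simp only [Finset.mem_product, Finset.mem_univ, and_true, mem_shuffles_iff]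
      constructor
      · refine Monotone.strictMono_of_injective ?_ ?_
        · have := Tuple.monotone_sort (fun j : Fin p => σ (Fin.castAdd q j))
          simpa [blkPerm_castAdd, Function.comp_def] using this
        · intro a b h
          simpa [blkPerm_castAdd] using h
      · refine Monotone.strictMono_of_injective ?_ ?_
        · have := Tuple.monotone_sort (fun j : Fin q => σ (Fin.natAdd p j))
          simpa [blkPerm_natAdd, Function.comp_def] using this
        · intro a b h
          simpa [blkPerm_natAdd] using h
    · apply blkPerm_ext
      · intro j; simp [blkPerm_castAdd]
      · intro j; simp [blkPerm_natAdd]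
  · intro a _; rfl

lemma card_shuffles (p q : ℕ) :
    (shuffles (p + q) p).card * (p.factorial * q.factorial) = (p + q).factorial := by
  have := sum_perm_shuffles p q (fun _ => (1 : ℕ))
  simp [Fintype.card_perm] at this
  rw [this]

/-! ### Koszul sign -/

section koszul
variable {R : Type*} [Ring R] [Algebra ℚ R]

def Ksgn {A : Type*} [LinearOrder A] (d : A → ℕ) : List A → ℚ
  | [] => 1
  | a :: l => (l.map fun b => if b < a then ((-1 : ℚ)) ^ (d a * d b) else 1).prod * Ksgn d l

lemma prod_orderedInsert {A : Type*} [LinearOrder A] (d : A → ℕ) (y : A → R)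
    (hy : ∀ a b, y a * y b = ((-1 : ℚ)) ^ (d a * d b) • (y b * y a)) (a : A) (l : List A)
    (hl : l.Pairwise (· ≤ ·)) :
    y a * (l.map y).prod =
      (l.map fun b => if b < a then ((-1 : ℚ)) ^ (d a * d b) else 1).prod •
        ((l.orderedInsert (· ≤ ·) a).map y).prod := by
  induction l with
  | nil => simp
  | cons b l ih =>
    rw [List.pairwise_cons] at hl
    by_cases hab : a ≤ b
    · have h1 : (((b :: l).map fun b => if b < a then ((-1 : ℚ)) ^ (d a * d b) else 1)).prod = 1 := by
        apply List.prod_eq_one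
        intro x hx
        rw [List.mem_map] at hx
        obtain ⟨c, hc, rfl⟩ := hx
        have : a ≤ c := by
          rcases List.mem_cons.1 hc with rfl | hc
          · exact hab
          · exact hab.trans (hl.1 c hc)
        rw [if_neg (not_lt.2 this)]
      rw [h1, List.orderedInsert_cons, if_pos hab, one_smul]
      simp
    · rw [List.orderedInsert_cons, if_neg hab]
      simp only [List.map_cons, List.prod_cons, if_pos (not_le.1 hab)]
      rw [← mul_assoc, hy a b, smul_mul_assoc, mul_assoc, ih hl.2, mul_smul_comm, smul_smul]

lemma prod_sort {A : Type*} [LinearOrder A] (d : A → ℕ) (y : A → R)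
    (hy : ∀ a b, y a * y b = ((-1 : ℚ)) ^ (d a * d b) • (y b * y a)) (l : List A) :
    (l.map y).prod = Ksgn d l • ((l.insertionSort (· ≤ ·)).map y).prod := by
  induction l with
  | nil => simp [Ksgn]
  | cons a l ih =>
    rw [List.map_cons, List.prod_cons, ih, mul_smul_comm, List.insertionSort_cons,
      prod_orderedInsert d y hy a _ (List.pairwise_insertionSort _ _), smul_smul, Ksgn, mul_comm]
    congr 2
    exact ((List.perm_insertionSort (· ≤ ·) l).map _).prod_eq

lemma Ksgn_ofFn {A : Type*} [LinearOrder A] (d : A → ℕ) (k : ℕ) (f : Fin k → A) :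
    Ksgn d (List.ofFn f) = ∏ a : Fin k, ∏ b : Fin k,
      if a < b ∧ f b < f a then ((-1 : ℚ)) ^ (d (f a) * d (f b)) else 1 := by
  induction k with
  | zero => simp [Ksgn]
  | succ k ih =>
    rw [List.ofFn_succ, Ksgn, ih, Fin.prod_univ_succ]
    congr 1
    · rw [List.map_ofFn, List.prod_ofFn, Fin.prod_univ_succ]
      simp
    · refine Finset.prod_congr rfl fun a _ => ?_
      rw [Fin.prod_univ_succ]
      simp

lemma Ksgn_perm (k : ℕ) (d : Fin k → ℕ) (σ : Equiv.Perm (Fin k)) :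
    Ksgn d (List.ofFn σ) = koszulSign k d σ := by
  rw [Ksgn_ofFn, koszulSign, Finset.prod_filter, ← Finset.univ_product_univ, Finset.prod_product]

lemma prod_perm_koszul (k : ℕ) (d : Fin k → ℕ) (σ : Equiv.Perm (Fin k)) (y : Fin k → R)
    (hy : ∀ a b, y a * y b = ((-1 : ℚ)) ^ (d a * d b) • (y b * y a)) :
    ((List.finRange k).map fun m => y (σ m)).prod =
      koszulSign k d σ • ((List.finRange k).map y).prod := by
  have h := prod_sort d y hy (List.ofFn σ)
  rw [Ksgn_perm] at h
  have h2 : (List.ofFn σ).insertionSort (· ≤ ·) = List.finRange k := by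
    apply List.Perm.eq_of_pairwise (le := (· ≤ ·))
    · intro a b _ _ h1 h2; exact le_antisymm h1 h2
    · exact List.pairwise_insertionSort _ _
    · exact (List.pairwise_le_finRange k)
    · refine (List.perm_insertionSort _ _).trans ?_
      rw [List.ofFn_eq_map]
      exact Equiv.Perm.map_finRange_perm σ
  rw [h2] at h
  rw [← h, List.ofFn_eq_map, List.map_map]
  rfl

lemma koszulSign_sq (k : ℕ) (d : Fin k → ℕ) (σ : Equiv.Perm (Fin k)) :
    koszulSign k d σ * koszulSign k d σ = 1 := by
  rw [koszulSign, ← Finset.prod_mul_distrib]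
  apply Finset.prod_eq_one
  intro p _
  rw [← mul_pow]; simp

end koszul


/-! ### The auxiliary exterior algebra `Λ(ℚ^i)` recording signs -/

abbrev LamA (i : ℕ) : Type := ExteriorAlgebra ℚ (Fin i → ℚ)

noncomputable def theta {i s : ℕ} (w : Fin s → Fin i) : LamA i :=
  ExteriorAlgebra.ιMulti ℚ s (fun j => (Pi.single (w j) 1 : Fin i → ℚ))

lemma theta_append {i s t : ℕ} (w : Fin s → Fin i) (w' : Fin t → Fin i) :
    theta (Fin.append w w') = theta w * theta w' := by
  simp only [theta, ExteriorAlgebra.ιMulti_apply]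
  rw [← List.prod_append, ← List.ofFn_fin_append]
  congr 2
  ext j
  refine Fin.addCases (fun j => ?_) (fun j => ?_) j <;> simp

lemma iota_mul_list {i : ℕ} (x : Fin i → ℚ) (l : List (Fin i → ℚ)) :
    ExteriorAlgebra.ι ℚ x * (l.map (ExteriorAlgebra.ι ℚ)).prod =
      ((-1 : ℚ)) ^ l.length • ((l.map (ExteriorAlgebra.ι ℚ)).prod * ExteriorAlgebra.ι ℚ x) := by
  induction l with
  | nil => simp
  | cons y l ih =>
    have h : ExteriorAlgebra.ι ℚ x * ExteriorAlgebra.ι ℚ y =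
        (-1 : ℚ) • (ExteriorAlgebra.ι ℚ y * ExteriorAlgebra.ι ℚ x) := by
      rw [neg_one_smul]
      exact eq_neg_of_add_eq_zero_left (ExteriorAlgebra.ι_add_mul_swap x y)
    simp only [List.map_cons, List.prod_cons, List.length_cons]
    rw [← mul_assoc, h, smul_mul_assoc, mul_assoc, ih, mul_smul_comm, smul_smul, pow_succ', mul_assoc]

lemma list_mul_list {i : ℕ} (l l' : List (Fin i → ℚ)) :
    (l.map (ExteriorAlgebra.ι ℚ)).prod * (l'.map (ExteriorAlgebra.ι ℚ)).prod =
      ((-1 : ℚ)) ^ (l.length * l'.length) •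
        ((l'.map (ExteriorAlgebra.ι ℚ)).prod * (l.map (ExteriorAlgebra.ι ℚ)).prod) := by
  induction l with
  | nil => simp
  | cons y l ih =>
    simp only [List.map_cons, List.prod_cons, List.length_cons]
    rw [mul_assoc, ih, mul_smul_comm, ← mul_assoc, iota_mul_list, smul_mul_assoc, smul_smul,
      ← pow_add, mul_assoc]
    congr 2
    ring

lemma theta_comm {i s t : ℕ} (w : Fin s → Fin i) (w' : Fin t → Fin i) :
    theta w * theta w' = ((-1 : ℚ)) ^ (s * t) • (theta w' * theta w) := by
  have := list_mul_list (List.ofFn fun j => (Pi.single (w j) 1 : Fin i → ℚ))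
    (List.ofFn fun j => (Pi.single (w' j) 1 : Fin i → ℚ))
  simpa [theta, ExteriorAlgebra.ιMulti_apply, List.map_ofFn, Function.comp_def] using this

noncomputable def topf (i : ℕ) : LamA i →ₗ[ℚ] ℚ :=
  ExteriorAlgebra.liftAlternating
    (Function.update (fun _ => 0) i (Matrix.detRowAlternating (n := Fin i) (R := ℚ)))

lemma topf_theta_ne {i s : ℕ} (h : s ≠ i) (w : Fin s → Fin i) : topf i (theta w) = 0 := by
  rw [topf, theta, ExteriorAlgebra.liftAlternating_apply_ιMulti, Function.update_of_ne h]
  rfl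

lemma topf_theta {i : ℕ} (w : Fin i → Fin i) : topf i (theta w) =
    Matrix.detRowAlternating (n := Fin i) (R := ℚ) (fun j => (Pi.single (w j) 1 : Fin i → ℚ)) := by
  rw [topf, theta, ExteriorAlgebra.liftAlternating_apply_ιMulti, Function.update_self]

lemma topf_theta_perm {i : ℕ} (σ : Equiv.Perm (Fin i)) :
    topf i (theta σ) = ((Equiv.Perm.sign σ : ℤ) : ℚ) := by
  rw [topf_theta]
  have := (Matrix.detRowAlternating (n := Fin i) (R := ℚ)).map_perm
    (fun j => (Pi.single j 1 : Fin i → ℚ)) σ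
  have h2 : (Matrix.detRowAlternating (n := Fin i) (R := ℚ))
      (fun j => (Pi.single j 1 : Fin i → ℚ)) = 1 := by
    have h3 : (fun j => (Pi.single j 1 : Fin i → ℚ)) = (1 : Matrix (Fin i) (Fin i) ℚ) := by
      ext a b; simp [Matrix.one_apply, Pi.single_apply, eq_comm]
    rw [h3]
    exact Matrix.det_one
  rw [h2] at this
  simp only [Function.comp_def] at this
  rw [this, Units.smul_def]
  simp

lemma sum_topf_theta {i : ℕ} {M : Type*} [AddCommGroup M] [Module ℚ M]
    (Φ : (Fin i → Fin i) → M) :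
    ∑ w : Fin i → Fin i, topf i (theta w) • Φ w =
      ∑ σ : Equiv.Perm (Fin i), ((Equiv.Perm.sign σ : ℤ) : ℚ) • Φ σ := by
  classical
  symm
  refine Finset.sum_bij_ne_zero (fun σ _ _ => (σ : Fin i → Fin i)) (fun _ _ _ => Finset.mem_univ _)
    (fun a _ _ b _ _ h => Equiv.coe_fn_injective h) ?_ ?_
  · intro w _ hw
    have hinj : Function.Injective w := by
      by_contra hcon
      apply hw
      rw [topf_theta, AlternatingMap.map_eq_zero_of_not_injective, zero_smul]
      intro h
      exact hcon fun a b hab => h (by simp only [hab])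
    have hb := Finite.injective_iff_bijective.1 hinj
    refine ⟨Equiv.ofBijective w hb, Finset.mem_univ _, ?_, rfl⟩
    rw [← topf_theta_perm]
    exact hw
  · intro σ _ _
    rw [topf_theta_perm]

noncomputable def Topm (i : ℕ) (T : Type*) [AddCommGroup T] [Module ℚ T] :
    LamA i ⊗[ℚ] T →ₗ[ℚ] T :=
  (TensorProduct.lid ℚ T).toLinearMap ∘ₗ (topf i).rTensor T

lemma Topm_tmul (i : ℕ) (T : Type*) [AddCommGroup T] [Module ℚ T] (a : LamA i) (t : T) :
    Topm i T (a ⊗ₜ t) = topf i a • t := by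
  simp [Topm]

/-! ### Blocks -/

section blocks
variable {n : ℕ} (C : SymModel n) (πt : EA n →ₗ[ℚ] EA n)

noncomputable def blockVal (β : ℕ × Bool) (v : Fin β.1 → MT n) : C.S :=
  if hs : 0 < β.1 then
    (if β.2 then C.ι β.1 (πt (ctreeT n β.1 hs v)) else C.ι β.1 (eps n (cwheelT n β.1 v)))
  else 1

lemma blockProd_cons (β : ℕ × Bool) (L : List (ℕ × Bool)) (off : ℕ) (w : ℕ → MT n) :
    blockProd n C πt (β :: L) off w =
      blockVal C πt β (fun t => w (off + (t : ℕ))) * blockProd n C πt L (off + β.1) w := rfl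

lemma blockVal_eq (β : ℕ × Bool) (h : 0 < β.1) (v : Fin β.1 → MT n) :
    ∃ y : EA n, blockVal C πt β v = C.ι β.1 y := by
  rw [blockVal, dif_pos h]
  split_ifs
  · exact ⟨_, rfl⟩
  · exact ⟨_, rfl⟩

lemma blockVal_comm (β β' : ℕ × Bool) (v : Fin β.1 → MT n) (v' : Fin β'.1 → MT n) :
    blockVal C πt β v * blockVal C πt β' v' =
      ((-1 : ℚ)) ^ (β.1 * β'.1) • (blockVal C πt β' v' * blockVal C πt β v) := by
  by_cases h : 0 < β.1
  · by_cases h' : 0 < β'.1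
    · obtain ⟨y, hy⟩ := blockVal_eq C πt β h v
      obtain ⟨y', hy'⟩ := blockVal_eq C πt β' h' v'
      rw [hy, hy', C.comm β'.1 β.1, mul_comm β.1]
    · have h0 : β'.1 = 0 := by omega
      rw [blockVal, blockVal, dif_neg h', h0]
      simp
  · have h0 : β.1 = 0 := by omega
    rw [blockVal, dif_neg h, h0]
    simp

def bsize (L : List (ℕ × Bool)) : ℕ := (L.map Prod.fst).sum

lemma bsize_cons (β : ℕ × Bool) (L : List (ℕ × Bool)) : bsize (β :: L) = β.1 + bsize L := by
  simp [bsize]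

def extv {m : ℕ} (v : Fin m → MT n) : ℕ → MT n := fun t => if h : t < m then v ⟨t, h⟩ else 0

lemma blockProd_congr (L : List (ℕ × Bool)) : ∀ (off off' : ℕ) (w w' : ℕ → MT n),
    (∀ t < bsize L, w (off + t) = w' (off' + t)) →
    blockProd n C πt L off w = blockProd n C πt L off' w' := by
  induction L with
  | nil => intros; rfl
  | cons β L ih =>
    intro off off' w w' h
    rw [bsize_cons] at h
    rw [blockProd_cons, blockProd_cons]
    congr 1
    · congr 1
      ext1 t
      exact h t (by have := t.isLt; omega)
    · apply ih
      intro t ht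
      rw [add_assoc, add_assoc]
      exact h _ (by omega)

variable {i : ℕ} (u : Fin i → MT n)

noncomputable def Xb (β : ℕ × Bool) : LamA i ⊗[ℚ] C.S :=
  ∑ w : Fin β.1 → Fin i, theta w ⊗ₜ[ℚ] blockVal C πt β (fun t => u (w t))

lemma Xb_commute (β β' : ℕ × Bool) : Commute (Xb C πt u β) (Xb C πt u β') := by
  unfold Xb
  refine Commute.sum_left _ _ _ fun w _ => Commute.sum_right _ _ _ fun w' _ => ?_
  rw [Commute, SemiconjBy, Algebra.TensorProduct.tmul_mul_tmul, Algebra.TensorProduct.tmul_mul_tmul,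
    theta_comm, blockVal_comm, TensorProduct.smul_tmul_smul, ← mul_pow]
  simp

lemma words (L : List (ℕ × Bool)) : ∀ m, bsize L = m →
    (L.map (Xb C πt u)).prod = ∑ w : Fin m → Fin i,
      theta w ⊗ₜ[ℚ] blockProd n C πt L 0 (extv fun t => u (w t)) := by
  induction L with
  | nil =>
    intro m hm
    have hm' : 0 = m := hm
    subst hm'
    rw [List.map_nil, List.prod_nil]
    rw [Fintype.sum_unique]
    simp [theta, blockProd, Algebra.TensorProduct.one_def]
  | cons β L ih =>
    intro m hm
    rw [bsize_cons] at hm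
    subst hm
    rw [List.map_cons, List.prod_cons, ih _ rfl, Xb, Finset.sum_mul_sum,
      ← (Fin.appendEquiv (α := Fin i) β.1 (bsize L)).sum_comp, Fintype.sum_prod_type]
    refine Finset.sum_congr rfl fun w _ => Finset.sum_congr rfl fun w' _ => ?_
    rw [Algebra.TensorProduct.tmul_mul_tmul]
    show _ = theta (Fin.append w w') ⊗ₜ[ℚ]
      blockProd n C πt (β :: L) 0 (extv fun t => u (Fin.append w w' t))
    rw [theta_append, blockProd_cons]
    congr 2
    · congr 1
      ext1 t
      have h : 0 + (t : ℕ) < β.1 + bsize L := by have := t.isLt; omega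
      have h2 : (⟨0 + (t : ℕ), h⟩ : Fin (β.1 + bsize L)) = Fin.castAdd _ t := by ext; simp
      rw [extv, dif_pos h, h2, Fin.append_left]
    · apply blockProd_congr
      intro t ht
      have h : 0 + β.1 + t < β.1 + bsize L := by omega
      have h2 : (⟨0 + β.1 + t, h⟩ : Fin (β.1 + bsize L)) = Fin.natAdd _ ⟨t, ht⟩ := by ext; simp
      rw [extv, dif_pos (by omega), extv, dif_pos h, h2, Fin.append_right]
      simp

noncomputable def Gr (L : List (ℕ × Bool)) : C.S :=
  ∑ σ : Equiv.Perm (Fin i), ((Equiv.Perm.sign σ : ℤ) : ℚ) •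
    blockProd n C πt L 0 (extv fun t => u (σ t))

lemma Topm_prod (L : List (ℕ × Bool)) :
    Topm i C.S (L.map (Xb C πt u)).prod = if bsize L = i then Gr C πt u L else 0 := by
  split_ifs with h
  · rw [words C πt u L i h, map_sum]
    simp only [Topm_tmul]
    rw [sum_topf_theta (fun w => blockProd n C πt L 0 (extv fun t => u (w t)))]
    rfl
  · rw [words C πt u L _ rfl, map_sum]
    apply Finset.sum_eq_zero
    intro w _
    rw [Topm_tmul, topf_theta_ne h, zero_smul]

end blocks


/-! ### The comultiplication on products of blocks -/

lemma take_drop_prod {R : Type*} [Monoid R] (k p : ℕ) (f g : Fin k → R) :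
    ((List.finRange k).map fun m : Fin k => if (m : ℕ) < p then f m else g m).prod =
      (((List.finRange k).take p).map f).prod * (((List.finRange k).drop p).map g).prod := by
  conv_lhs => rw [← List.take_append_drop p (List.finRange k)]
  rw [List.map_append, List.prod_append]
  congr 2
  · apply List.map_congr_left
    intro m hm
    rw [List.mem_take_iff_getElem] at hm
    obtain ⟨j, hj, rfl⟩ := hm
    rw [if_pos]
    simp at hj ⊢
    omega
  · apply List.map_congr_left
    intro m hm
    rw [List.mem_drop_iff_getElem] at hm
    obtain ⟨j, hj, rfl⟩ := hm
    rw [if_neg]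
    simp

lemma list_prod_tmul {A B ι : Type*} [Ring A] [Ring B] [Algebra ℚ A] [Algebra ℚ B] (l : List ι)
    (a : ι → A) (b : ι → B) :
    (l.map fun m => a m ⊗ₜ[ℚ] b m).prod = (l.map a).prod ⊗ₜ[ℚ] (l.map b).prod := by
  induction l with
  | nil => simp [Algebra.TensorProduct.one_def]
  | cons x l ih => simp [ih]

lemma list_prod_sum {A : Type*} [Ring A] [Algebra ℚ A] (k : ℕ) (κ : Fin k → Type)
    [∀ j, Fintype (κ j)] (f : ∀ j, κ j → A) :
    ((List.finRange k).map fun j => ∑ w, f j w).prod =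
      ∑ w : ∀ j, κ j, ((List.finRange k).map fun j => f j (w j)).prod := by
  classical
  have := (MultilinearMap.mkPiAlgebraFin ℚ k A).map_sum f
  simpa only [MultilinearMap.mkPiAlgebraFin_apply, List.ofFn_eq_map] using this

section comul
variable {n : ℕ} (C : SymModel n) (πt : EA n →ₗ[ℚ] EA n)
variable {i : ℕ} (u : Fin i → MT n)

noncomputable def jl (i : ℕ) : LamA i ⊗[ℚ] C.S →ₐ[ℚ] LamA i ⊗[ℚ] (C.S ⊗[ℚ] C.S) :=
  Algebra.TensorProduct.map (AlgHom.id ℚ (LamA i)) Algebra.TensorProduct.includeLeft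

noncomputable def jr (i : ℕ) : LamA i ⊗[ℚ] C.S →ₐ[ℚ] LamA i ⊗[ℚ] (C.S ⊗[ℚ] C.S) :=
  Algebra.TensorProduct.map (AlgHom.id ℚ (LamA i)) Algebra.TensorProduct.includeRight

lemma jl_tmul (a : LamA i) (s : C.S) : jl C i (a ⊗ₜ s) = a ⊗ₜ (s ⊗ₜ 1) := by
  simp [jl]

lemma jr_tmul (a : LamA i) (s : C.S) : jr C i (a ⊗ₜ s) = a ⊗ₜ (1 ⊗ₜ s) := by
  simp [jr]

lemma Topm_Delta (z : LamA i ⊗[ℚ] C.S) :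
    C.Δ (Topm i C.S z) = Topm i (C.S ⊗[ℚ] C.S) (C.Δ.lTensor (LamA i) z) := by
  induction z with
  | zero => simp
  | tmul a s => rw [Topm_tmul, LinearMap.lTensor_tmul, Topm_tmul, map_smul]
  | add x y hx hy => simp only [map_add, hx, hy]

lemma includeLeft_list (l : List C.S) :
    ((l.map fun s => (s ⊗ₜ[ℚ] (1 : C.S) : C.S ⊗[ℚ] C.S))).prod = l.prod ⊗ₜ 1 := by
  have := list_prod_tmul l (fun s => s) (fun _ => (1 : C.S))
  simpa using this

lemma includeRight_list (l : List C.S) :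
    ((l.map fun s => ((1 : C.S) ⊗ₜ[ℚ] s : C.S ⊗[ℚ] C.S))).prod = 1 ⊗ₜ l.prod := by
  have := list_prod_tmul l (fun _ => (1 : C.S)) (fun s => s)
  simpa using this

lemma Delta_prod (k : ℕ) (β : Fin k → ℕ × Bool) (hβ : ∀ j, 0 < (β j).1) :
    C.Δ.lTensor (LamA i) ((List.finRange k).map fun j => Xb C πt u (β j)).prod =
      ∑ p ∈ Finset.range (k + 1), ∑ τ ∈ shuffles k p,
        jl C i (((List.finRange k).take p).map fun m => Xb C πt u (β (τ m))).prod *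
        jr C i (((List.finRange k).drop p).map fun m => Xb C πt u (β (τ m))).prod := by
  choose y hy using fun (j : Fin k) (w : Fin (β j).1 → Fin i) =>
    blockVal_eq C πt (β j) (hβ j) (fun t => u (w t))
  have hX : ∀ j, Xb C πt u (β j) = ∑ w, theta w ⊗ₜ[ℚ] C.ι (β j).1 (y j w) := by
    intro j
    exact Finset.sum_congr rfl fun w _ => by rw [hy]
  have key : ∀ (p : ℕ) (τ : Equiv.Perm (Fin k)),
      jl C i (((List.finRange k).take p).map fun m => Xb C πt u (β (τ m))).prod *
      jr C i (((List.finRange k).drop p).map fun m => Xb C πt u (β (τ m))).prod =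
      ∑ w : ∀ j, (Fin (β j).1 → Fin i),
        ((List.finRange k).map fun j => theta (w j)).prod ⊗ₜ[ℚ]
        (koszulSign k (fun j => (β j).1) τ •
          ((((List.finRange k).take p).map fun m => C.ι (β (τ m)).1 (y (τ m) (w (τ m)))).prod
            ⊗ₜ[ℚ]
           (((List.finRange k).drop p).map fun m => C.ι (β (τ m)).1 (y (τ m) (w (τ m)))).prod)) := by
    intro p τ
    rw [map_list_prod, map_list_prod, List.map_map, List.map_map, ← take_drop_prod]
    have e1 : (fun m : Fin k => if (m : ℕ) < p then
        ((jl C i) ∘ fun m => Xb C πt u (β (τ m))) m else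
        ((jr C i) ∘ fun m => Xb C πt u (β (τ m))) m) =
        fun m => ∑ w : Fin (β (τ m)).1 → Fin i, theta w ⊗ₜ[ℚ]
          (if (m : ℕ) < p then (C.ι (β (τ m)).1 (y (τ m) w) ⊗ₜ[ℚ] (1 : C.S))
            else ((1 : C.S) ⊗ₜ[ℚ] C.ι (β (τ m)).1 (y (τ m) w))) := by
      ext1 m
      split_ifs
      · simp only [Function.comp_apply, hX, map_sum, jl_tmul]
      · simp only [Function.comp_apply, hX, map_sum, jr_tmul]
    let eqv : (∀ j, Fin (β j).1 → Fin i) ≃ (∀ m, Fin (β (τ m)).1 → Fin i) :=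
      Equiv.piCongrLeft' (fun j => Fin (β j).1 → Fin i) τ.symm
    rw [e1, list_prod_sum k (fun m => Fin (β (τ m)).1 → Fin i) (fun m w => theta w ⊗ₜ[ℚ]
          (if (m : ℕ) < p then (C.ι (β (τ m)).1 (y (τ m) w) ⊗ₜ[ℚ] (1 : C.S))
            else ((1 : C.S) ⊗ₜ[ℚ] C.ι (β (τ m)).1 (y (τ m) w)))),
      ← eqv.sum_comp]
    refine Finset.sum_congr rfl fun w _ => ?_
    rw [list_prod_tmul]
    have e2 : ((List.finRange k).map fun m => theta
        (eqv w m)).prod =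
        koszulSign k (fun j => (β j).1) τ • ((List.finRange k).map fun j => theta (w j)).prod :=
      prod_perm_koszul k (fun j => (β j).1) τ (fun j => theta (w j))
        (fun a b => theta_comm _ _)
    rw [e2, TensorProduct.smul_tmul]
    congr 2
    refine (take_drop_prod k p _ _).trans ?_
    have e3 := includeLeft_list C
      (((List.finRange k).take p).map fun m => C.ι (β (τ m)).1 (y (τ m) (w (τ m))))
    have e4 := includeRight_list C
      (((List.finRange k).drop p).map fun m => C.ι (β (τ m)).1 (y (τ m) (w (τ m))))
    rw [List.map_map] at e3 e4
    refine (congrArg₂ (· * ·) e3 e4).trans ?_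
    simp
  simp_rw [key]
  simp_rw [hX]
  rw [list_prod_sum k (fun j => Fin (β j).1 → Fin i)
    (fun j w => theta w ⊗ₜ[ℚ] C.ι (β j).1 (y j w)), map_sum]
  simp_rw [list_prod_tmul, LinearMap.lTensor_tmul, C.Δ_spec k (fun j => (β j).1),
    TensorProduct.tmul_sum]
  rw [Finset.sum_comm]
  refine Finset.sum_congr rfl fun p _ => ?_
  rw [Finset.sum_comm]

lemma shuf_sum {i r m : ℕ} {M : Type*} [AddCommGroup M] [Module ℚ M] (h : r + m = i)
    (Φ : (Fin r → Fin i) → (Fin m → Fin i) → M) :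
    ∑ w1 : Fin r → Fin i, ∑ w2 : Fin m → Fin i, topf i (theta (Fin.append w1 w2)) • Φ w1 w2 =
      ∑ τ ∈ shuffles i r, ((Equiv.Perm.sign τ : ℤ) : ℚ) •
        ∑ α : Equiv.Perm (Fin r), ∑ γ : Equiv.Perm (Fin m),
          (((Equiv.Perm.sign α : ℤ) : ℚ) * ((Equiv.Perm.sign γ : ℤ) : ℚ)) •
          Φ (fun t => τ ⟨α t, by have := (α t).isLt; omega⟩)
            (fun t => τ ⟨r + γ t, by have := (γ t).isLt; omega⟩) := by
  subst h
  have e : ∑ w : Fin (r + m) → Fin (r + m), topf (r + m) (theta w) •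
      Φ (fun t => w (Fin.castAdd m t)) (fun t => w (Fin.natAdd r t)) =
      ∑ w1 : Fin r → Fin (r + m), ∑ w2 : Fin m → Fin (r + m),
        topf (r + m) (theta (Fin.append w1 w2)) • Φ w1 w2 := by
    rw [← (Fin.appendEquiv (α := Fin (r + m)) r m).sum_comp, Fintype.sum_prod_type]
    refine Finset.sum_congr rfl fun w _ => Finset.sum_congr rfl fun w' _ => ?_
    simp [Fin.appendEquiv]
  rw [← e, sum_topf_theta (fun w => Φ (fun t => w (Fin.castAdd m t)) (fun t => w (Fin.natAdd r t))),
    sum_perm_shuffles]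
  refine Finset.sum_congr rfl fun τ _ => ?_
  simp_rw [Finset.smul_sum]
  refine Finset.sum_congr rfl fun α _ => Finset.sum_congr rfl fun γ _ => ?_
  rw [smul_smul]
  simp only [Equiv.Perm.sign_mul, sign_blkPerm, Equiv.Perm.mul_apply, blkPerm_castAdd,
    blkPerm_natAdd]
  push_cast
  rfl

noncomputable def Qb (L1 L2 : List (ℕ × Bool)) : C.S ⊗[ℚ] C.S :=
  Topm i (C.S ⊗[ℚ] C.S)
    (jl C i (L1.map (Xb C πt u)).prod * jr C i (L2.map (Xb C πt u)).prod)

lemma Qb_expand (L1 L2 : List (ℕ × Bool)) (r m : ℕ) (h1 : bsize L1 = r) (h2 : bsize L2 = m) :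
    Qb C πt u L1 L2 = ∑ w1 : Fin r → Fin i, ∑ w2 : Fin m → Fin i,
      topf i (theta (Fin.append w1 w2)) •
        (blockProd n C πt L1 0 (extv fun t => u (w1 t)) ⊗ₜ[ℚ]
          blockProd n C πt L2 0 (extv fun t => u (w2 t))) := by
  rw [Qb, words C πt u L1 r h1, words C πt u L2 m h2, map_sum, map_sum, Finset.sum_mul_sum, map_sum]
  refine Finset.sum_congr rfl fun w _ => ?_
  rw [map_sum]
  refine Finset.sum_congr rfl fun w' _ => ?_
  rw [jl_tmul, jr_tmul, Algebra.TensorProduct.tmul_mul_tmul, Algebra.TensorProduct.tmul_mul_tmul,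
    Topm_tmul, theta_append, one_mul, mul_one]

lemma Qb_zero (L1 L2 : List (ℕ × Bool)) (h : bsize L1 + bsize L2 ≠ i) : Qb C πt u L1 L2 = 0 := by
  rw [Qb_expand C πt u L1 L2 _ _ rfl rfl]
  refine Finset.sum_eq_zero fun w _ => Finset.sum_eq_zero fun w' _ => ?_
  rw [topf_theta_ne h, zero_smul]

lemma Qb_eq (L1 L2 : List (ℕ × Bool)) (r m : ℕ) (h1 : bsize L1 = r) (h2 : bsize L2 = m)
    (h : r + m = i) :
    Qb C πt u L1 L2 = ∑ τ ∈ shuffles i r, ((Equiv.Perm.sign τ : ℤ) : ℚ) •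
      (Gr C πt (fun t : Fin r => u (τ ⟨t, by have := t.isLt; omega⟩)) L1 ⊗ₜ[ℚ]
        Gr C πt (fun t : Fin m => u (τ ⟨r + t, by have := t.isLt; omega⟩)) L2) := by
  rw [Qb_expand C πt u L1 L2 r m h1 h2, shuf_sum h (fun w1 w2 =>
        (blockProd n C πt L1 0 (extv fun t => u (w1 t)) ⊗ₜ[ℚ]
          blockProd n C πt L2 0 (extv fun t => u (w2 t))))]
  refine Finset.sum_congr rfl fun τ _ => ?_
  congr 1
  rw [Gr, Gr, TensorProduct.sum_tmul]
  refine Finset.sum_congr rfl fun α _ => ?_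
  rw [TensorProduct.tmul_sum]
  refine Finset.sum_congr rfl fun γ _ => ?_
  rw [TensorProduct.smul_tmul_smul]

lemma shuf_lt1 {i : ℕ} (p : {x // x ∈ Finset.range (i + 1)}) (t : Fin p.1) : (t : ℕ) < i :=
  lt_of_lt_of_le t.isLt (Nat.lt_succ_iff.1 (Finset.mem_range.mp p.2))

lemma shuf_lt2 {i : ℕ} (p : {x // x ∈ Finset.range (i + 1)}) (t : Fin (i - p.1)) :
    p.1 + (t : ℕ) < i := by
  have := Finset.mem_range.mp p.2
  have := t.isLt
  omega

lemma Qb_full (L1 L2 : List (ℕ × Bool)) :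
    Qb C πt u L1 L2 = ∑ p ∈ (Finset.range (i + 1)).attach, ∑ τ ∈ shuffles i p.1,
      ((Equiv.Perm.sign τ : ℤ) : ℚ) •
      ((if bsize L1 = p.1 then
        Gr C πt (fun t : Fin p.1 => u (τ ⟨(t : ℕ), shuf_lt1 p t⟩)) L1 else 0) ⊗ₜ[ℚ]
       (if bsize L2 = i - p.1 then
        Gr C πt (fun t : Fin (i - p.1) => u (τ ⟨p.1 + (t : ℕ), shuf_lt2 p t⟩)) L2 else 0)) := by
  by_cases h : bsize L1 + bsize L2 = i
  · rw [Finset.sum_eq_single ⟨bsize L1, by rw [Finset.mem_range]; omega⟩]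
    · rw [Qb_eq C πt u L1 L2 (bsize L1) (i - bsize L1) rfl (by omega) (by omega)]
      refine Finset.sum_congr rfl fun τ _ => ?_
      rw [if_pos rfl, if_pos (by show bsize L2 = i - bsize L1; omega)]
    · intro p _ hp
      refine Finset.sum_eq_zero fun τ _ => ?_
      rw [if_neg, TensorProduct.zero_tmul, smul_zero]
      intro h'
      exact hp (Subtype.ext h'.symm)
    · intro h'
      exact absurd (Finset.mem_attach _ _) h'
  · rw [Qb_zero C πt u L1 L2 h]
    symm
    refine Finset.sum_eq_zero fun p _ => Finset.sum_eq_zero fun τ _ => ?_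
    have hp := Finset.mem_range.mp p.2
    by_cases h1 : bsize L1 = p.1
    · rw [if_neg (c := bsize L2 = i - p.1) (by omega), TensorProduct.tmul_zero, smul_zero]
    · rw [if_neg h1, TensorProduct.zero_tmul, smul_zero]

end comul


/-! ### From pairs of partitions to sequences of blocks -/

lemma exists_comm_model {A : Type} [Ring A] [Algebra ℚ A] {ι : Type} (X : ι → A)
    (h : ∀ a b, Commute (X a) (X b)) :
    ∃ (R : Type) (_ : CommRing R) (_ : Algebra ℚ R) (v : R →ₐ[ℚ] A) (x : ι → R),
      ∀ b, v (x b) = X b := by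
  letI := Algebra.adjoinCommRingOfComm ℚ (s := Set.range X)
    (by rintro _ ⟨a, rfl⟩ _ ⟨b, rfl⟩; exact h a b)
  exact ⟨Algebra.adjoin ℚ (Set.range X), inferInstance, inferInstance,
    (Algebra.adjoin ℚ (Set.range X)).val, fun b => ⟨X b, Algebra.subset_adjoin ⟨b, rfl⟩⟩,
    fun b => rfl⟩

abbrev PPt (p : ℕ) : Type := (Fin (p + 1) → Fin (p + 1)) × (Fin (p + 1) → Fin (p + 1))

def Mf {p : ℕ} (pp : PPt p) (k : ℕ) (b : Bool) : ℕ :=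
  if h : k < p + 1 then (if b then (pp.1 ⟨k, h⟩ : ℕ) else (pp.2 ⟨k, h⟩ : ℕ)) else 0

lemma flatMap_map_prod {R A B : Type*} [CommMonoid R] (x : B → R) (f : A → List B) (l : List A) :
    ((l.flatMap f).map x).prod = (l.map fun a => ((f a).map x).prod).prod := by
  induction l with
  | nil => simp
  | cons a l ih => simp [ih]

lemma list_range_prod {R : Type*} [CommMonoid R] (f : ℕ → R) (n : ℕ) :
    ((List.range n).map f).prod = ∏ k ∈ Finset.range n, f k := by
  induction n with
  | zero => simp
  | succ n ih => simp [List.range_succ, Finset.prod_range_succ, ih]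

lemma blockList_prod {R : Type*} [CommMonoid R] (x : ℕ × Bool → R) {p : ℕ} (pp : PPt p) :
    ((blockList p pp.1 pp.2).map x).prod =
      (∏ k ∈ Finset.range (p + 1), x (k, true) ^ Mf pp k true) *
      ∏ k ∈ Finset.range (p + 1), x (k, false) ^ Mf pp k false := by
  rw [blockList, List.map_append, List.prod_append, flatMap_map_prod, flatMap_map_prod,
    List.map_reverse, List.map_reverse, List.prod_reverse, List.prod_reverse, list_range_prod,
    list_range_prod]
  congr 1
  · refine Finset.prod_congr rfl fun k hk => ?_
    have hk' := Finset.mem_range.1 hk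
    simp [Mf, hk']
  · refine Finset.prod_congr rfl fun k hk => ?_
    have hk' := Finset.mem_range.1 hk
    simp [Mf, hk']

@[to_additive]
lemma range_shift_prod {R : Type*} [CommMonoid R] (f : ℕ → R) (p N : ℕ) (hpN : p ≤ N)
    (h0 : f 0 = 1) (h1 : ∀ k, p < k → f k = 1) :
    ∏ k ∈ Finset.range (p + 1), f k = ∏ a : Fin N, f ((a : ℕ) + 1) := by
  rw [Fin.prod_univ_eq_prod_range (fun a => f (a + 1)) N]
  have := Finset.prod_range_succ' f N
  rw [h0, mul_one] at this
  rw [← this]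
  refine Finset.prod_subset (Finset.range_subset_range.2 (by omega)) ?_
  intro k _ hk
  apply h1
  rw [Finset.mem_range] at hk
  omega

def blk {N : ℕ} (b : Fin N × Bool) : ℕ × Bool := ((b.1 : ℕ) + 1, b.2)

def mB {p : ℕ} (N : ℕ) (pp : PPt p) (b : Fin N × Bool) : ℕ := Mf pp ((b.1 : ℕ) + 1) b.2

lemma Mf_zero {p : ℕ} (pp : PPt p) (h : validPP p pp) (b : Bool) : Mf pp 0 b = 0 := by
  cases b
  · have := h.2.1
    simpa [Mf] using this
  · have := h.1
    simpa [Mf] using this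

lemma Mf_large {p : ℕ} (pp : PPt p) (k : ℕ) (h : p < k) (b : Bool) : Mf pp k b = 0 := by
  rw [Mf, dif_neg (by omega)]

lemma blockList_prod_mB {R : Type*} [CommMonoid R] (x : ℕ × Bool → R) {p N : ℕ} (hpN : p ≤ N)
    (pp : PPt p) (h : validPP p pp) :
    ((blockList p pp.1 pp.2).map x).prod = ∏ b : Fin N × Bool, x (blk b) ^ mB N pp b := by
  rw [blockList_prod, range_shift_prod (fun k => x (k, true) ^ Mf pp k true) p N hpN
      (by simp [Mf_zero pp h]) (fun k hk => by simp [Mf_large pp k hk]),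
    range_shift_prod (fun k => x (k, false) ^ Mf pp k false) p N hpN
      (by simp [Mf_zero pp h]) (fun k hk => by simp [Mf_large pp k hk]),
    Fintype.prod_prod_type, ← Finset.prod_mul_distrib]
  refine Finset.prod_congr rfl fun a _ => ?_
  rw [Fintype.prod_bool]
  rfl

lemma normPP_mB {p N : ℕ} (hpN : p ≤ N) (pp : PPt p) (h : validPP p pp) :
    normPP p pp = ∏ b : Fin N × Bool, (1 / (((mB N pp b).factorial : ℕ) : ℚ)) := by
  have e : normPP p pp = ∏ k : Fin (p + 1), (fun k : ℕ =>
      (1 / (((Mf pp k true).factorial : ℕ) : ℚ)) * (1 / (((Mf pp k false).factorial : ℕ) : ℚ))) k := by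
    rw [normPP]
    refine Finset.prod_congr rfl fun k _ => ?_
    have hk : (k : ℕ) < p + 1 := k.isLt
    simp [Mf, hk, mul_comm]
  rw [e, Fin.prod_univ_eq_prod_range (fun k : ℕ =>
      (1 / (((Mf pp k true).factorial : ℕ) : ℚ)) * (1 / (((Mf pp k false).factorial : ℕ) : ℚ))),
    range_shift_prod _ p N hpN (by simp [Mf_zero pp h]) (fun k hk => by simp [Mf_large pp k hk]),
    Fintype.prod_prod_type]
  refine Finset.prod_congr rfl fun a _ => ?_
  rw [Fintype.prod_bool]
  rfl

lemma sum_mB {p N : ℕ} (hpN : p ≤ N) (pp : PPt p) :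
    ∑ k : Fin (p + 1), (k : ℕ) * ((pp.1 k : ℕ) + (pp.2 k : ℕ)) =
      ∑ b : Fin N × Bool, ((b.1 : ℕ) + 1) * mB N pp b := by
  have e : ∑ k : Fin (p + 1), (k : ℕ) * ((pp.1 k : ℕ) + (pp.2 k : ℕ)) =
      ∑ k : Fin (p + 1), (fun k : ℕ => k * (Mf pp k true + Mf pp k false)) k := by
    refine Finset.sum_congr rfl fun k _ => ?_
    have hk : (k : ℕ) < p + 1 := k.isLt
    simp [Mf, hk]
  rw [e, Fin.sum_univ_eq_sum_range (fun k : ℕ => k * (Mf pp k true + Mf pp k false)),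
    range_shift_sum _ p N hpN (by simp) (fun k hk => by simp [Mf_large pp k hk]),
    Fintype.sum_prod_type]
  refine Finset.sum_congr rfl fun a _ => ?_
  rw [Fintype.sum_bool, mul_add]
  rfl

lemma two_pow_bsize (L : List (ℕ × Bool)) : (L.map fun β => 2 ^ β.1).prod = 2 ^ bsize L := by
  induction L with
  | nil => simp [bsize]
  | cons β L ih => simp [bsize_cons, ih, pow_add]

lemma bsize_blockList {p : ℕ} (pp : PPt p) (h : validPP p pp) :
    bsize (blockList p pp.1 pp.2) = p := by
  have h2 := h.2.2
  rw [sum_mB le_rfl] at h2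
  have := blockList_prod_mB (fun β : ℕ × Bool => 2 ^ β.1) le_rfl pp h
  rw [two_pow_bsize] at this
  simp only [← pow_mul] at this
  rw [Finset.prod_pow_eq_pow_sum] at this
  have := Nat.pow_right_injective le_rfl this
  rw [this]
  exact h2

def listOf {N : ℕ} (m : Fin N × Bool → ℕ) : List (ℕ × Bool) :=
  (List.finRange N).flatMap fun a => List.replicate (m (a, true)) ((a : ℕ) + 1, true) ++
    List.replicate (m (a, false)) ((a : ℕ) + 1, false)

lemma listOf_prod {R : Type*} [CommMonoid R] {N : ℕ} (x : ℕ × Bool → R) (m : Fin N × Bool → ℕ) :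
    ((listOf m).map x).prod = ∏ b, x (blk b) ^ m b := by
  rw [listOf, flatMap_map_prod, ← List.ofFn_eq_map, List.prod_ofFn, Fintype.prod_prod_type]
  refine Finset.prod_congr rfl fun a _ => ?_
  simp [blk]

lemma bsize_listOf {N : ℕ} (m : Fin N × Bool → ℕ) :
    bsize (listOf m) = ∑ b : Fin N × Bool, ((b.1 : ℕ) + 1) * m b := by
  have := listOf_prod (fun β : ℕ × Bool => 2 ^ β.1) m
  rw [two_pow_bsize] at this
  simp only [← pow_mul] at this
  rw [Finset.prod_pow_eq_pow_sum] at this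
  exact Nat.pow_right_injective le_rfl this

open Classical in
lemma comb_identity {R M : Type*} [CommRing R] [Algebra ℚ R] [AddCommGroup M] [Module ℚ M]
    (x : ℕ × Bool → R) (T : R →ₗ[ℚ] M) (p N K : ℕ) (hpN : p ≤ N) (hpK : p ≤ K)
    (hT : ∀ L : List (ℕ × Bool), bsize L ≠ p → T (L.map x).prod = 0) :
    ∑ pp ∈ Finset.univ.filter (validPP p), normPP p pp • T ((blockList p pp.1 pp.2).map x).prod =
      ∑ k ∈ Finset.range (K + 1), (1 / ((k.factorial : ℕ) : ℚ)) •
        T ((∑ b : Fin N × Bool, x (blk b)) ^ k) := by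
  have hR : ∀ k, (1 / ((k.factorial : ℕ) : ℚ)) • T ((∑ b : Fin N × Bool, x (blk b)) ^ k) =
      ∑ m ∈ Finset.piAntidiag (Finset.univ : Finset (Fin N × Bool)) k,
        (∏ b, (1 / (((m b).factorial : ℕ) : ℚ))) • T (∏ b, x (blk b) ^ m b) := by
    intro k
    rw [Finset.sum_pow_eq_sum_piAntidiag, map_sum, Finset.smul_sum]
    refine Finset.sum_congr rfl fun m hm => ?_
    rw [Finset.mem_piAntidiag] at hm
    rw [← nsmul_eq_mul, map_nsmul, ← Nat.cast_smul_eq_nsmul ℚ, smul_smul]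
    congr 1
    have hs := Nat.multinomial_spec (Finset.univ : Finset (Fin N × Bool)) m
    rw [hm.1] at hs
    have hs' : (∏ b, (((m b).factorial : ℕ) : ℚ)) *
        (Nat.multinomial Finset.univ m : ℚ) = ((k.factorial : ℕ) : ℚ) := by
      rw [← hs]; push_cast; rfl
    have hk : ((k.factorial : ℕ) : ℚ) ≠ 0 := by exact_mod_cast k.factorial_ne_zero
    have hp : (∏ b, (((m b).factorial : ℕ) : ℚ)) ≠ 0 :=
      Finset.prod_ne_zero_iff.2 fun b _ => by exact_mod_cast (m b).factorial_ne_zero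
    simp only [one_div, Finset.prod_inv_distrib]
    field_simp
    rw [← hs']; ring
  simp_rw [hR]
  rw [Finset.sum_sigma']
  refine Finset.sum_bij_ne_zero (fun pp _ _ => ⟨∑ b, mB N pp b, mB N pp⟩) ?_ ?_ ?_ ?_
  · intro pp hpp _
    rw [Finset.mem_filter] at hpp
    simp only [Finset.mem_sigma, Finset.mem_range, Finset.mem_piAntidiag]
    refine ⟨?_, trivial, fun _ _ => Finset.mem_univ _⟩
    have h1 := hpp.2.2.2
    rw [sum_mB hpN] at h1
    have : ∑ b, mB N pp b ≤ ∑ b : Fin N × Bool, ((b.1 : ℕ) + 1) * mB N pp b :=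
      Finset.sum_le_sum fun b _ => Nat.le_mul_of_pos_left _ (by omega)
    omega
  · intro pp hpp _ pp' hpp' _ heq
    rw [Finset.mem_filter] at hpp hpp'
    have hm : mB N pp = mB N pp' := by
      have := congrArg Sigma.snd heq
      exact this
    have hM : ∀ k : Fin (p + 1), ∀ b, Mf pp k b = Mf pp' k b := by
      intro k b
      by_cases hk : (k : ℕ) = 0
      · rw [hk, Mf_zero pp hpp.2, Mf_zero pp' hpp'.2]
      · have h1 := congrFun hm (⟨(k : ℕ) - 1, by have := k.isLt; omega⟩, b)
        have h2 : (k : ℕ) - 1 + 1 = k := by omega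
        simpa only [mB, h2] using h1
    refine Prod.ext (funext fun k => Fin.ext ?_) (funext fun k => Fin.ext ?_)
    · have := hM k true
      simpa [Mf, k.isLt] using this
    · have := hM k false
      simpa [Mf, k.isLt] using this
  · rintro ⟨k, m⟩ hkm hne
    simp only [Finset.mem_sigma, Finset.mem_range, Finset.mem_piAntidiag] at hkm
    have hsize : ∑ b : Fin N × Bool, ((b.1 : ℕ) + 1) * m b = p := by
      by_contra hcon
      apply hne
      rw [← bsize_listOf] at hcon
      have := hT _ hcon
      rw [listOf_prod] at this
      rw [this, smul_zero]
    have hle : ∀ b : Fin N × Bool, ((b.1 : ℕ) + 1) * m b ≤ p := fun b => by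
      rw [← hsize]
      exact Finset.single_le_sum (f := fun b : Fin N × Bool => ((b.1 : ℕ) + 1) * m b)
        (fun _ _ => Nat.zero_le _) (Finset.mem_univ b)
    have hle' : ∀ b : Fin N × Bool, m b ≤ p := fun b =>
      (Nat.le_mul_of_pos_left _ (by omega)).trans (hle b)
    let g : Bool → Fin (p + 1) → Fin (p + 1) := fun c k =>
      if h : 0 < (k : ℕ) then
        ⟨m (⟨(k : ℕ) - 1, by have := k.isLt; omega⟩, c), Nat.lt_succ_of_le (hle' _)⟩ else 0
    have hgm : mB N ((g true, g false) : PPt p) = m := by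
      ext ⟨a, c⟩
      by_cases ha : (a : ℕ) + 1 < p + 1
      · have hg : ∀ c, ((g c ⟨(a : ℕ) + 1, ha⟩ : Fin (p + 1)) : ℕ) = m (a, c) := fun c =>
          congrArg Fin.val (dif_pos (Nat.succ_pos _))
        rw [mB, Mf, dif_pos ha]
        cases c
        · exact hg false
        · exact hg true
      · have h1 := hle (a, c)
        have h2 : m (a, c) = 0 := by
          by_contra h0
          have : (a : ℕ) + 1 ≤ ((a : ℕ) + 1) * m (a, c) :=
            Nat.le_mul_of_pos_right _ (by omega)
          simp only at h1
          omega
        rw [h2, mB, Mf_large _ _ (by simp only; omega)]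
    have hv : validPP p ((g true, g false) : PPt p) := by
      refine ⟨by simp [g], by simp [g], ?_⟩
      rw [sum_mB hpN, hgm, hsize]
    refine ⟨(g true, g false), by simp [hv], ?_, ?_⟩
    · rw [normPP_mB hpN _ hv, blockList_prod_mB x hpN _ hv, hgm]
      exact hne
    · rw [hgm, hkm.2.1]
  · intro pp hpp _
    rw [Finset.mem_filter] at hpp
    rw [normPP_mB hpN _ hpp.2, blockList_prod_mB x hpN _ hpp.2]

lemma pow_sum_list {A : Type*} [Ring A] [Algebra ℚ A] {κ : Type} [Fintype κ] (f : κ → A) (k : ℕ) :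
    (∑ b, f b) ^ k = ∑ β : Fin k → κ, ((List.finRange k).map fun j => f (β j)).prod := by
  rw [← list_prod_sum k (fun _ => κ) (fun _ => f)]
  simp

section final
variable {n : ℕ} (C : SymModel n) (πt : EA n →ₗ[ℚ] EA n)

lemma Fmap_eq {p : ℕ} (u : Fin p → MT n) (N K : ℕ) (hpN : p ≤ N) (hpK : p ≤ K) :
    Fmap n C πt p u = ∑ k ∈ Finset.range (K + 1), (1 / ((k.factorial : ℕ) : ℚ)) •
      ∑ β : Fin k → Fin N × Bool,
        Topm p C.S ((List.finRange k).map fun j => Xb C πt u (blk (β j))).prod := by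
  classical
  obtain ⟨R, _, _, v, x, hx⟩ := exists_comm_model (Xb C πt u) (Xb_commute C πt u)
  have hv : ∀ L : List (ℕ × Bool), v (L.map x).prod = (L.map (Xb C πt u)).prod := by
    intro L
    rw [map_list_prod, List.map_map]
    congr 2
    ext1 b
    exact hx b
  have h := comb_identity x ((Topm p C.S) ∘ₗ v.toLinearMap) p N K hpN hpK (by
    intro L hL
    simp only [LinearMap.comp_apply, AlgHom.toLinearMap_apply]
    rw [hv, Topm_prod, if_neg hL])
  simp only [LinearMap.comp_apply, AlgHom.toLinearMap_apply, hv] at h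
  simp only [map_pow, map_sum, hx] at h
  simp only [pow_sum_list, map_sum] at h
  rw [← h, Fmap]
  refine Finset.sum_congr (by congr) fun pp hpp => ?_
  rw [Finset.mem_filter] at hpp
  rw [Topm_prod, if_pos (bsize_blockList pp hpp.2)]
  rfl

end final



section assembly
variable {n : ℕ} (C : SymModel n) (πt : EA n →ₗ[ℚ] EA n) {i : ℕ} (u : Fin i → MT n)

noncomputable def Wb (k1 k2 : ℕ) : C.S ⊗[ℚ] C.S :=
  ∑ β1 : Fin k1 → Fin i × Bool, ∑ β2 : Fin k2 → Fin i × Bool,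
    Qb C πt u ((List.finRange k1).map fun j => blk (β1 j))
      ((List.finRange k2).map fun j => blk (β2 j))

lemma le_bsize_blk {N k : ℕ} (β : Fin k → Fin N × Bool) :
    k ≤ bsize ((List.finRange k).map fun j => blk (β j)) := by
  have : ∀ l : List (Fin k), l.length ≤ bsize (l.map fun j => blk (β j)) := by
    intro l
    induction l with
    | nil => simp
    | cons a l ih =>
      rw [List.map_cons, bsize_cons, List.length_cons]
      simp only [blk] at ih ⊢
      omega
  simpa using this (List.finRange k)

lemma Wb_zero (k1 k2 : ℕ) (h : i < k1 + k2) : Wb C πt u k1 k2 = 0 := by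
  rw [Wb]
  refine Finset.sum_eq_zero fun β1 _ => Finset.sum_eq_zero fun β2 _ => ?_
  apply Qb_zero
  have h1 := le_bsize_blk β1
  have h2 := le_bsize_blk β2
  omega

lemma split_append {X Y : Type*} (p q : ℕ) (f : X → Y) (γ1 : Fin p → X) (γ2 : Fin q → X) :
    (((List.finRange (p + q)).take p).map fun m => f (Fin.append γ1 γ2 m)) =
      (List.finRange p).map (fun j => f (γ1 j)) ∧
    (((List.finRange (p + q)).drop p).map fun m => f (Fin.append γ1 γ2 m)) =
      (List.finRange q).map (fun j => f (γ2 j)) := by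
  have h : (List.finRange (p + q)).map (fun m => f (Fin.append γ1 γ2 m)) =
      (List.finRange p).map (fun j => f (γ1 j)) ++ (List.finRange q).map (fun j => f (γ2 j)) := by
    have h0 : (List.finRange (p + q)).map (Fin.append γ1 γ2) =
        (List.finRange p).map γ1 ++ (List.finRange q).map γ2 := by
      rw [← List.ofFn_eq_map, ← List.ofFn_eq_map, ← List.ofFn_eq_map, List.ofFn_fin_append]
    have := congrArg (List.map f) h0
    simpa [List.map_map, Function.comp_def] using this
  rw [List.map_take, List.map_drop, h]
  exact ⟨List.take_left' (by simp), List.drop_left' (by simp)⟩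

lemma lhs_term (p q : ℕ) :
    ∑ β : Fin (p + q) → Fin i × Bool, ∑ τ ∈ shuffles (p + q) p,
      Topm i (C.S ⊗[ℚ] C.S)
        (jl C i (((List.finRange (p + q)).take p).map fun m => Xb C πt u (blk (β (τ m)))).prod *
        jr C i (((List.finRange (p + q)).drop p).map fun m => Xb C πt u (blk (β (τ m)))).prod) =
      (((shuffles (p + q) p).card : ℕ) : ℚ) • Wb C πt u p q := by
  rw [Finset.sum_comm, Nat.cast_smul_eq_nsmul, ← Finset.sum_const]
  refine Finset.sum_congr rfl fun τ _ => ?_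
  rw [← ((Equiv.arrowCongr τ (Equiv.refl (Fin i × Bool)))).sum_comp,
    ← (Fin.appendEquiv (α := Fin i × Bool) p q).sum_comp, Fintype.sum_prod_type, Wb]
  refine Finset.sum_congr rfl fun γ1 _ => Finset.sum_congr rfl fun γ2 _ => ?_
  have h := split_append p q (fun b => Xb C πt u (blk b)) γ1 γ2
  rw [Qb, List.map_map, List.map_map]
  have e : ∀ m, (Equiv.arrowCongr τ (Equiv.refl (Fin i × Bool)))
      ((Fin.appendEquiv (α := Fin i × Bool) p q) (γ1, γ2)) (τ m) = Fin.append γ1 γ2 m := by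
    intro m
    simp [Equiv.arrowCongr, Fin.appendEquiv]
  simp only [e]
  rw [h.1, h.2]
  rfl

lemma lhs_eq : C.Δ (Fmap n C πt i u) =
    ∑ k ∈ Finset.range (i + 1), ∑ p ∈ Finset.range (k + 1),
      ((1 / ((p.factorial : ℕ) : ℚ)) * (1 / (((k - p).factorial : ℕ) : ℚ))) •
        Wb C πt u p (k - p) := by
  rw [Fmap_eq C πt u i i le_rfl le_rfl, map_sum]
  refine Finset.sum_congr rfl fun k _ => ?_
  rw [map_smul, map_sum]
  have h : ∀ β : Fin k → Fin i × Bool,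
      C.Δ (Topm i C.S ((List.finRange k).map fun j => Xb C πt u (blk (β j))).prod) =
      ∑ p ∈ Finset.range (k + 1), ∑ τ ∈ shuffles k p, Topm i (C.S ⊗[ℚ] C.S)
        (jl C i (((List.finRange k).take p).map fun m => Xb C πt u (blk (β (τ m)))).prod *
        jr C i (((List.finRange k).drop p).map fun m => Xb C πt u (blk (β (τ m)))).prod) := by
    intro β
    rw [Topm_Delta, Delta_prod C πt u k (fun j => blk (β j)) (fun j => Nat.succ_pos _), map_sum]
    simp only [map_sum]
  simp only [h]
  rw [Finset.sum_comm, Finset.smul_sum]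
  refine Finset.sum_congr rfl fun p hp => ?_
  obtain ⟨q, rfl⟩ : ∃ q, k = p + q := ⟨k - p, by have := Finset.mem_range.1 hp; omega⟩
  rw [lhs_term, Nat.add_sub_cancel_left, smul_smul]
  congr 1
  have hc := card_shuffles p q
  have hc' : (((shuffles (p + q) p).card : ℕ) : ℚ) * (((p.factorial : ℕ) : ℚ) *
      ((q.factorial : ℕ) : ℚ)) = (((p + q).factorial : ℕ) : ℚ) := by
    exact_mod_cast hc
  have h1 : ((p.factorial : ℕ) : ℚ) ≠ 0 := by exact_mod_cast p.factorial_ne_zero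
  have h2 : ((q.factorial : ℕ) : ℚ) ≠ 0 := by exact_mod_cast q.factorial_ne_zero
  have h3 : (((p + q).factorial : ℕ) : ℚ) ≠ 0 := by exact_mod_cast (p + q).factorial_ne_zero
  field_simp
  rw [← hc']; ring

lemma reindex {M : Type*} [AddCommMonoid M] (i : ℕ) (G : ℕ → ℕ → M)
    (hG : ∀ a b, i < a + b → G a b = 0) :
    ∑ k ∈ Finset.range (i + 1), ∑ p ∈ Finset.range (k + 1), G p (k - p) =
      ∑ a ∈ Finset.range (i + 1), ∑ b ∈ Finset.range (i + 1), G a b := by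
  rw [Finset.sum_sigma', Finset.sum_sigma']
  refine Finset.sum_bij_ne_zero (fun x _ _ => ⟨x.2, x.1 - x.2⟩) ?_ ?_ ?_ ?_
  · rintro ⟨k, p⟩ h _
    simp only [Finset.mem_sigma, Finset.mem_range] at h ⊢
    omega
  · rintro ⟨k, p⟩ h _ ⟨k', p'⟩ h' _ he
    simp only [Finset.mem_sigma, Finset.mem_range] at h h'
    simp only [Sigma.mk.injEq, heq_eq_eq] at he ⊢
    omega
  · rintro ⟨a, b⟩ h hne
    have hab : a + b ≤ i := by
      by_contra hcon
      exact hne (hG a b (by omega))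
    refine ⟨⟨a + b, a⟩, ?_, ?_, ?_⟩
    · simp only [Finset.mem_sigma, Finset.mem_range]; omega
    · simpa using hne
    · simp
  · rintro ⟨k, p⟩ _ _
    rfl

lemma Fmap_Gr {p : ℕ} (v : Fin p → MT n) (N : ℕ) (h : p ≤ N) :
    Fmap n C πt p v = ∑ x ∈ (Finset.range (N + 1)).sigma
        (fun k => (Finset.univ : Finset (Fin k → Fin N × Bool))),
      (1 / ((x.1.factorial : ℕ) : ℚ)) •
        (if bsize ((List.finRange x.1).map fun j => blk (x.2 j)) = p then
          Gr C πt v ((List.finRange x.1).map fun j => blk (x.2 j)) else 0) := by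
  rw [Fmap_eq C πt v N N h h, Finset.sum_sigma]
  refine Finset.sum_congr rfl fun k _ => ?_
  rw [Finset.smul_sum]
  refine Finset.sum_congr rfl fun β _ => ?_
  rw [← Topm_prod, List.map_map]
  rfl

lemma rhs_eq : (∑ p ∈ (Finset.range (i + 1)).attach, ∑ σ ∈ shuffles i p.1,
          ((Equiv.Perm.sign σ : ℤ) : ℚ) •
            (Fmap n C πt p.1
                (fun t => u (σ ⟨(t : ℕ), shuf_lt1 p t⟩)) ⊗ₜ[ℚ]
             Fmap n C πt (i - p.1)
                (fun t => u (σ ⟨p.1 + (t : ℕ), shuf_lt2 p t⟩)))) =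
    ∑ a ∈ Finset.range (i + 1), ∑ b ∈ Finset.range (i + 1),
      ((1 / ((a.factorial : ℕ) : ℚ)) * (1 / ((b.factorial : ℕ) : ℚ))) • Wb C πt u a b := by
  set I := (Finset.range (i + 1)).sigma
        (fun k => (Finset.univ : Finset (Fin k → Fin i × Bool))) with hI
  have hR : ∑ a ∈ Finset.range (i + 1), ∑ b ∈ Finset.range (i + 1),
      ((1 / ((a.factorial : ℕ) : ℚ)) * (1 / ((b.factorial : ℕ) : ℚ))) • Wb C πt u a b =
      ∑ x ∈ I, ∑ y ∈ I, ((1 / ((x.1.factorial : ℕ) : ℚ)) * (1 / ((y.1.factorial : ℕ) : ℚ))) •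
        Qb C πt u ((List.finRange x.1).map fun j => blk (x.2 j))
          ((List.finRange y.1).map fun j => blk (y.2 j)) := by
    rw [hI, Finset.sum_sigma]
    refine Finset.sum_congr rfl fun a _ => ?_
    simp only [Finset.sum_sigma, Wb, Finset.smul_sum]
    rw [Finset.sum_comm]
  rw [hR]
  simp only [Qb_full, Finset.smul_sum]
  have hcomm : ∀ (f : (Σ k, Fin k → Fin i × Bool) → (Σ k, Fin k → Fin i × Bool) →
      ∀ p : {x // x ∈ Finset.range (i + 1)}, Equiv.Perm (Fin i) → C.S ⊗[ℚ] C.S),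
      ∑ x ∈ I, ∑ y ∈ I, ∑ p ∈ (Finset.range (i + 1)).attach, ∑ σ ∈ shuffles i p.1, f x y p σ =
      ∑ p ∈ (Finset.range (i + 1)).attach, ∑ σ ∈ shuffles i p.1, ∑ x ∈ I, ∑ y ∈ I, f x y p σ := by
    intro f
    have h1 : ∀ x, ∑ y ∈ I, ∑ p ∈ (Finset.range (i + 1)).attach, ∑ σ ∈ shuffles i p.1, f x y p σ =
      ∑ p ∈ (Finset.range (i + 1)).attach, ∑ σ ∈ shuffles i p.1, ∑ y ∈ I, f x y p σ := by
      intro x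
      rw [Finset.sum_comm]
      exact Finset.sum_congr rfl fun p _ => Finset.sum_comm
    simp only [h1]
    rw [Finset.sum_comm]
    exact Finset.sum_congr rfl fun p _ => Finset.sum_comm
  rw [hcomm]
  refine Finset.sum_congr rfl fun p _ => Finset.sum_congr rfl fun σ _ => ?_
  have hp := Finset.mem_range.1 p.2
  rw [Fmap_Gr C πt _ i (by omega : p.1 ≤ i), Fmap_Gr C πt _ i (by omega : i - p.1 ≤ i), ← hI,
    TensorProduct.sum_tmul, Finset.smul_sum]
  refine Finset.sum_congr rfl fun x _ => ?_
  rw [TensorProduct.tmul_sum, Finset.smul_sum]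
  refine Finset.sum_congr rfl fun y _ => ?_
  rw [TensorProduct.smul_tmul_smul, smul_comm]

end assembly


theorem stmt_11 (n : ℕ) (C : SymModel n)
    (πt : EA n →ₗ[ℚ] EA n)
    -- `πt` is the projection onto `U^tree` along `U^wheel = im ε`:
    (hπ1 : ∀ v : EA n, πt v - v ∈ LinearMap.range (eps n))
    (hπ2 : ∀ w : ExteriorAlgebra ℚ (Fin n → ℚ), πt (eps n w) = 0) :
    -- `F_*` is a coalgebra map: `Δ ∘ F = (F ⊗ F) ∘ Δ^U` on `Λ* U`,
    -- verified on tuples of (antisymmetric) elements of `U`: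
    ∀ (i : ℕ) (u : Fin i → MT n),
      (∀ (j : Fin i) (a b c : Fin n), u j (a, b, c) = - u j (b, a, c)) →
      C.Δ (Fmap n C πt i u) =
        ∑ p ∈ (Finset.range (i + 1)).attach, ∑ σ ∈ shuffles i p.1,
          ((Equiv.Perm.sign σ : ℤ) : ℚ) •
            (Fmap n C πt p.1
                (fun t => u (σ ⟨(t : ℕ), by
                  have := Finset.mem_range.mp p.2; have := t.isLt; omega⟩)) ⊗ₜ[ℚ]
             Fmap n C πt (i - p.1)
                (fun t => u (σ ⟨p.1 + (t : ℕ), by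
                  have := Finset.mem_range.mp p.2; have := t.isLt; omega⟩))) := by

  intro i u _
  rw [rhs_eq, lhs_eq]
  exact reindex i (fun a b => ((1 / ((a.factorial : ℕ) : ℚ)) *
    (1 / ((b.factorial : ℕ) : ℚ))) • Wb C πt u a b)
    (fun a b h => by simp only [Wb_zero C πt u a b h, smul_zero])
end
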